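/- arXiv:1604.00101 — 3 statements merged into one kernel-verified Lean document; each statement's English description precedes it below -/
import Mathlib

section
/- Let σ ∈ (0,2), β ∈ (0,1], and R > 0. Let η : ℝ → ℝ be a smooth even nonnegative function with unit integral vanishing outside (−1,1), and for a bounded continuous function u on ℝ₀^{d+1} with finite [u]^t_{Λ¹} define the time-mollification u^{(R)}(t,x) = ∫_ℝ (2u(t − R^σ s, x) − u(t − 2R^σ s, x)) η(s−1) ds. Then [∂_t u^{(R)}]^t_{β; ℝ₀^{d+1}} ≤ C(β) R^{−βσ} [u]^t_{Λ¹}, where C(β) depends only on β and η. -/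
open MeasureTheory Set Metric ENNReal
open scoped Classical
noncomputable section

namespace Nonlocal

variable {d : ℕ}

/-- `d`-dimensional Euclidean space. -/
abbrev E (d : ℕ) : Type := EuclideanSpace ℝ (Fin d)

/-- The parabolic cylinder `Q_r(t,x) = (t - r^σ, t) × B_r(x)`. -/
def Q (σ r t : ℝ) (x : E d) : Set (ℝ × E d) := Ioo (t - r ^ σ) t ×ˢ ball x r

/-- `Q_r = Q_r(0,0)`. -/
def Q0 (d : ℕ) (σ r : ℝ) : Set (ℝ × E d) := Q σ r 0 (0 : E d)

/-- The lower half space `ℝ₀^{d+1} = (-∞,0) × ℝ^d`. -/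
def lowerHalf (d : ℕ) : Set (ℝ × E d) := Iio (0 : ℝ) ×ˢ (univ : Set (E d))

/-- The spatial differential `Du`. -/
def Du (u : ℝ × E d → ℝ) (z : ℝ × E d) : E d →L[ℝ] ℝ :=
  fderiv ℝ (fun x => u (z.1, x)) z.2

/-- The time derivative `∂_t u`. -/
def ut (u : ℝ × E d → ℝ) (z : ℝ × E d) : ℝ :=
  deriv (fun s => u (s, z.2)) z.1

/-- The increment `δu(t,x,y)`, whose form depends on the order `σ`. -/
def deltaU (σ : ℝ) (u : ℝ × E d → ℝ) (t : ℝ) (x y : E d) : ℝ :=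
  u (t, x + y) - u (t, x) -
    (if 1 < σ then Du u (t, x) y
      else if σ = 1 then (if ‖y‖ < 1 then Du u (t, x) y else 0) else 0)

/-- Ellipticity bounds `λ(2-σ)|y|^{-d-σ} ≤ K(y) ≤ Λ(2-σ)|y|^{-d-σ}`. -/
def kernelBounds (σ lam Lam : ℝ) (K : E d → ℝ) : Prop :=
  ∀ y : E d, y ≠ 0 →
    lam * (2 - σ) * ‖y‖ ^ (-((d : ℝ) + σ)) ≤ K y ∧
      K y ≤ Lam * (2 - σ) * ‖y‖ ^ (-((d : ℝ) + σ))

/-- Cancellation condition `∫_{∂B_r} y K(y) dS(y) = 0` for all `r > 0`,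
formulated equivalently via vanishing of the integrals over all annuli. -/
def cancels (K : E d → ℝ) : Prop :=
  ∀ r₁ r₂ : ℝ, 0 < r₁ → r₁ < r₂ →
    (∫ y in {y : E d | r₁ ≤ ‖y‖ ∧ ‖y‖ ≤ r₂}, K y • y) = 0

/-- Membership in the class `L₀`. -/
def memL0 (σ lam Lam : ℝ) (K : E d → ℝ) : Prop :=
  kernelBounds σ lam Lam K ∧ (σ = 1 → cancels K)

/-- The nonlocal operator `L u(t,x) = ∫ δu(t,x,y) K(y) dy` (translation invariant kernel). -/
def Lop (σ : ℝ) (K : E d → ℝ) (u : ℝ × E d → ℝ) (z : ℝ × E d) : ℝ :=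
  ∫ y, deltaU σ u z.1 z.2 y * K y

/-- The nonlocal operator with `(t,x)`-dependent kernel. -/
def LopTX (σ : ℝ) (K : ℝ × E d → E d → ℝ) (u : ℝ × E d → ℝ) (z : ℝ × E d) : ℝ :=
  ∫ y, deltaU σ u z.1 z.2 y * K z y

/-- The maximal Pucci extremal operator `M⁺`. -/
def Mplus (σ lam Lam : ℝ) (u : ℝ × E d → ℝ) (z : ℝ × E d) : ℝ :=
  if σ = 1 then sSup {v | ∃ K : E d → ℝ, memL0 1 lam Lam K ∧ v = Lop 1 K u z}
  else ∫ y, (Lam * max (deltaU σ u z.1 z.2 y) 0 - lam * max (-deltaU σ u z.1 z.2 y) 0) *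
      ((2 - σ) * ‖y‖ ^ (-((d : ℝ) + σ)))

/-- The minimal Pucci extremal operator `M⁻`. -/
def Mminus (σ lam Lam : ℝ) (u : ℝ × E d → ℝ) (z : ℝ × E d) : ℝ :=
  if σ = 1 then sInf {v | ∃ K : E d → ℝ, memL0 1 lam Lam K ∧ v = Lop 1 K u z}
  else ∫ y, (lam * max (deltaU σ u z.1 z.2 y) 0 - Lam * max (-deltaU σ u z.1 z.2 y) 0) *
      ((2 - σ) * ‖y‖ ^ (-((d : ℝ) + σ)))

variable {F : Type*} [NormedAddCommGroup F]

/-- The parabolic Hölder seminorm `[f]_{β,α;Ω}` (exponent `β` in time and `α` in space). -/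
def holderE (β α : ℝ) (Ω : Set (ℝ × E d)) (f : ℝ × E d → F) : ℝ≥0∞ :=
  ⨆ (p : Ω) (q : Ω), ENNReal.ofReal
    (‖f p.1 - f q.1‖ / max (‖p.1.2 - q.1.2‖ ^ α) (|p.1.1 - q.1.1| ^ β))

/-- The sup norm `‖f‖_{L∞(Ω)}`. -/
def supENorm (Ω : Set (ℝ × E d)) (f : ℝ × E d → F) : ℝ≥0∞ :=
  ⨆ p : Ω, ENNReal.ofReal ‖f p.1‖

/-- The full Hölder norm `‖f‖_{β,α;Ω}`. -/
def pnormE (β α : ℝ) (Ω : Set (ℝ × E d)) (f : ℝ × E d → ℝ) : ℝ≥0∞ :=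
  supENorm Ω f + holderE β α Ω f

/-- The seminorm `[u]_{1+α/σ, σ+α; Ω} = [D^ν u]_{α/σ, σ+α-ν; Ω} + [∂_t u]_{α/σ, σ+α-ν; Ω}`
with `ν = ⌊σ+α⌋`. -/
def parab2Semi (σ α : ℝ) (Ω : Set (ℝ × E d)) (u : ℝ × E d → ℝ) : ℝ≥0∞ :=
  holderE (α / σ) (σ + α - (⌊σ + α⌋₊ : ℝ)) Ω
      (fun z => iteratedFDeriv ℝ ⌊σ + α⌋₊ (fun x => u (z.1, x)) z.2)
    + holderE (α / σ) (σ + α - (⌊σ + α⌋₊ : ℝ)) Ω (fun z => ut u z)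

/-- General parabolic seminorm `[u]_{β/σ, β; Ω}` of order `β ≥ 0` (sup norm for `β = 0`);
a time-derivative term appears when `β > σ`. -/
def pSemiGen (σ β : ℝ) (Ω : Set (ℝ × E d)) (u : ℝ × E d → ℝ) : ℝ≥0∞ :=
  if β = 0 then supENorm Ω u
  else
    holderE (if σ < β then (β - σ) / σ else β / σ) (β - ((⌈β⌉₊ : ℝ) - 1)) Ω
        (fun z => iteratedFDeriv ℝ (⌈β⌉₊ - 1) (fun x => u (z.1, x)) z.2)
      + (if σ < β then
          holderE ((β - σ) / σ) (β - ((⌈β⌉₊ : ℝ) - 1)) Ω (fun z => ut u z) else 0)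

/-- Hölder seminorm in `x` only: `[f]^*_{β;Ω}`. -/
def holderX (β : ℝ) (Ω : Set (ℝ × E d)) (f : ℝ × E d → F) : ℝ≥0∞ :=
  ⨆ (t : ℝ) (x : E d) (y : E d) (_ : (t, x) ∈ Ω) (_ : (t, y) ∈ Ω),
    ENNReal.ofReal (‖f (t, x) - f (t, y)‖ / ‖x - y‖ ^ β)

/-- Hölder seminorm in `t` only: `[f]^t_{β;Ω}`. -/
def holderT (β : ℝ) (Ω : Set (ℝ × E d)) (f : ℝ × E d → F) : ℝ≥0∞ :=
  ⨆ (t : ℝ) (s : ℝ) (x : E d) (_ : (t, x) ∈ Ω) (_ : (s, x) ∈ Ω),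
    ENNReal.ofReal (‖f (t, x) - f (s, x)‖ / |t - s| ^ β)

/-- Zygmund seminorm in `t` only: `[u]^t_{Λ¹(Ω)}`. -/
def zygT (Ω : Set (ℝ × E d)) (u : ℝ × E d → ℝ) : ℝ≥0∞ :=
  ⨆ (t : ℝ) (x : E d) (h : ℝ) (_ : 0 < h) (_ : (t, x) ∈ Ω) (_ : (t + h, x) ∈ Ω)
    (_ : (t - h, x) ∈ Ω),
    ENNReal.ofReal (|u (t + h, x) + u (t - h, x) - 2 * u (t, x)| / h)

/-- Zygmund seminorm in `(t,x)`: `[u]_{Λ¹(Ω)}`. -/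
def zygFull (Ω : Set (ℝ × E d)) (u : ℝ × E d → ℝ) : ℝ≥0∞ :=
  ⨆ (z : ℝ × E d) (h : ℝ × E d) (_ : h ≠ 0) (_ : z ∈ Ω) (_ : z + h ∈ Ω) (_ : z - h ∈ Ω),
    ENNReal.ofReal (|u (z + h) + u (z - h) - 2 * u z| / ‖h‖)

/-- The function `P(t,x)` of Lemma 3.3. -/
def Pfun (σ : ℝ) (u : ℝ × E d → ℝ) (z : ℝ × E d) : ℝ :=
  ∫ y, max (deltaU σ u z.1 z.2 y - deltaU σ u 0 (0 : E d) y) 0 *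
    ((2 - σ) * ‖y‖ ^ (-((d : ℝ) + σ)))

/-- The function `N(t,x)` of Lemma 3.3. -/
def Nfun (σ : ℝ) (u : ℝ × E d → ℝ) (z : ℝ × E d) : ℝ :=
  ∫ y, max (-(deltaU σ u z.1 z.2 y - deltaU σ u 0 (0 : E d) y)) 0 *
    ((2 - σ) * ‖y‖ ^ (-((d : ℝ) + σ)))

/-- Mollification of `u` in the time variable: `u^{(R)}`. -/
def tmoll (σ R : ℝ) (η : ℝ → ℝ) (u : ℝ × E d → ℝ) : ℝ × E d → ℝ :=
  fun z => ∫ s : ℝ, (2 * u (z.1 - R ^ σ * s, z.2) - u (z.1 - 2 * R ^ σ * s, z.2)) * η (s - 1)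

/-- First-order Taylor expansion of `u^{(R)}` at the origin. -/
def tmollTaylor (σ R : ℝ) (η : ℝ → ℝ) (u : ℝ × E d → ℝ) : ℝ × E d → ℝ :=
  fun z => tmoll σ R η u (0, 0)
    + z.1 * derivWithin (fun s => tmoll σ R η u (s, (0 : E d))) (Iio (0 : ℝ)) 0
    + fderiv ℝ (fun x => tmoll σ R η u ((0 : ℝ), x)) 0 z.2

/-- Mollification of `u` in space-time (case `σ = 1`). -/
def stmoll (R : ℝ) (η : ℝ → ℝ) (ζ : E d → ℝ) (u : ℝ × E d → ℝ) : ℝ × E d → ℝ :=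
  fun z => ∫ w : ℝ × E d,
    (2 * u (z.1 - R * w.1, z.2 - R • w.2) - u (z.1 - 2 * R * w.1, z.2 - R • w.2)) *
      (η (w.1 - 1) * ζ w.2)

/-- First-order Taylor expansion of the space-time mollification at the origin. -/
def stmollTaylor (R : ℝ) (η : ℝ → ℝ) (ζ : E d → ℝ) (u : ℝ × E d → ℝ) : ℝ × E d → ℝ :=
  fun z => stmoll R η ζ u (0, 0)
    + z.1 * derivWithin (fun s => stmoll R η ζ u (s, (0 : E d))) (Iio (0 : ℝ)) 0
    + fderiv ℝ (fun x => stmoll R η ζ u ((0 : ℝ), x)) 0 z.2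

end Nonlocal
open MeasureTheory Set Metric ENNReal Nonlocal

theorem abs_le_of_zygmund_of_zero_endpoints {w : ℝ → ℝ} {p q Z : ℝ} (hpq : p ≤ q) (hZ : 0 ≤ Z)
    (hw : ContinuousOn w (Icc p q)) (hp : w p = 0) (hq : w q = 0)
    (hzyg : ∀ m h : ℝ, 0 < h → p ≤ m - h → m + h ≤ q →
      |w (m + h) + w (m - h) - 2 * w m| ≤ Z * h) :
    ∀ m ∈ Icc p q, |w m| ≤ Z * (q - p) := by
  obtain ⟨m, hm, hmax⟩ := isCompact_Icc.exists_isMaxOn (nonempty_Icc.2 hpq) hw.abs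
  have hmax' : ∀ y ∈ Icc p q, |w y| ≤ |w m| := fun y hy => hmax hy
  intro y hy
  refine (hmax' y hy).trans ?_
  have hprod : 0 ≤ Z * (q - p) := mul_nonneg hZ (sub_nonneg.2 hpq)
  have key : ∀ h : ℝ, 0 < h → p ≤ m - h → m + h ≤ q → (w (m + h) = 0 ∨ w (m - h) = 0) →
      |w m| ≤ Z * (q - p) := by
    intro h hh h1 h2 h0
    have hz := hzyg m h hh h1 h2
    have hle : Z * h ≤ Z * (q - p) := mul_le_mul_of_nonneg_left (by linarith) hZ
    have ha := hmax' (m + h) ⟨by linarith, h2⟩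
    have hb := hmax' (m - h) ⟨h1, by linarith⟩
    rw [abs_le] at hz
    rcases h0 with h0 | h0 <;> rw [h0] at hz <;>
      rcases abs_cases (w m) with ⟨e, _⟩ | ⟨e, _⟩ <;>
      rw [e] at ha hb ⊢ <;> rw [abs_le] at ha hb <;> linarith
  rcases eq_or_lt_of_le hm.1 with e | hpm
  · rwa [← e, hp, abs_zero]
  rcases eq_or_lt_of_le hm.2 with e | hmq
  · rwa [e, hq, abs_zero]
  rcases le_total (m - p) (q - m) with hle | hle
  · exact key (m - p) (by linarith) (by linarith) (by linarith) (Or.inr (by simpa using hp))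
  · exact key (q - m) (by linarith) (by linarith) (by linarith) (Or.inl (by simpa using hq))

/-- A function with Zygmund constant `Z` on `(-∞, c]` differs from its affine interpolation on
`[t - L, t]` by at most `Z * L`. -/
theorem exists_affine_approx_of_zygmund {F : ℝ → ℝ} {c Z : ℝ} (hZ : 0 ≤ Z) (hF : Continuous F)
    (hzyg : ∀ m h : ℝ, 0 < h → m + h ≤ c → |F (m + h) + F (m - h) - 2 * F m| ≤ Z * h)
    {t L : ℝ} (ht : t ≤ c) (hL : 0 < L) :
    ∃ A B : ℝ, ∀ y ∈ Icc (t - L) t, |F y - (A + B * y)| ≤ Z * L := by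
  set B := (F t - F (t - L)) / L with hB
  have hBL : B * L = F t - F (t - L) := by rw [hB]; field_simp
  refine ⟨F t - B * t, B, fun y hy => ?_⟩
  have := abs_le_of_zygmund_of_zero_endpoints (w := fun y => F y - (F t - B * t + B * y))
    (p := t - L) (q := t) (by linarith) hZ (by fun_prop)
    (by linarith) (by ring)
    (fun m h hh _ h2 => by
      have := hzyg m h hh (by linarith)
      convert this using 2
      ring) y hy
  simpa using this

theorem abs_integral_mul_comp_le_of_zygmund {F χ : ℝ → ℝ} {c Z L : ℝ} (hZ : 0 ≤ Z) (hL : 0 < L)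
    (hF : Continuous F)
    (hzyg : ∀ m h : ℝ, 0 < h → m + h ≤ c → |F (m + h) + F (m - h) - 2 * F m| ≤ Z * h)
    (hχ : Continuous χ) (hsupp : ∀ y, y ∉ Icc 0 L → χ y = 0)
    (h0 : ∫ y, χ y = 0) (h1 : ∫ y, χ y * y = 0) {a t : ℝ} (ha : 0 < a) (ht : t ≤ c) :
    |∫ y, χ y * F (t - a * y)| ≤ (L * ∫ y, |χ y|) * (a * Z) := by
  have hcs : HasCompactSupport χ := HasCompactSupport.intro isCompact_Icc hsupp
  have hint : ∀ G : ℝ → ℝ, Continuous G → Integrable (fun y => χ y * G y) := fun G hG =>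
    (hχ.mul hG).integrable_of_hasCompactSupport hcs.mul_right
  obtain ⟨A, B, hAB⟩ := exists_affine_approx_of_zygmund hZ hF hzyg ht (mul_pos ha hL)
  have haff : ∫ y, χ y * (A + B * (t - a * y)) = 0 := by
    have e : (fun y => χ y * (A + B * (t - a * y)))
        = fun y => (A + B * t) * χ y - (B * a) * (χ y * y) := by ext y; ring
    rw [e, integral_sub (((hχ.integrable_of_hasCompactSupport hcs)).const_mul _)
      ((hint (fun y => y) continuous_id).const_mul _), integral_const_mul, integral_const_mul, h0,
      h1]
    simp
  have heq : ∫ y, χ y * F (t - a * y)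
      = ∫ y, χ y * (F (t - a * y) - (A + B * (t - a * y))) := by
    simp_rw [mul_sub (χ _) (F _)]
    rw [integral_sub (hint _ (by fun_prop)) (hint _ (by fun_prop)), haff, sub_zero]
  have hbound : ∀ y, ‖χ y * (F (t - a * y) - (A + B * (t - a * y)))‖ ≤ |χ y| * (Z * (a * L)) := by
    intro y
    rw [norm_mul, Real.norm_eq_abs, Real.norm_eq_abs]
    by_cases hy : y ∈ Icc 0 L
    · refine mul_le_mul_of_nonneg_left (hAB _ ⟨?_, ?_⟩) (abs_nonneg _)
      · have := mul_le_mul_of_nonneg_left hy.2 ha.le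
        linarith
      · have := mul_nonneg ha.le hy.1
        linarith
    · simp [hsupp y hy]
  rw [heq]
  calc |∫ y, χ y * (F (t - a * y) - (A + B * (t - a * y)))|
      ≤ ∫ y, |χ y| * (Z * (a * L)) :=
        norm_integral_le_of_norm_le
          ((hχ.integrable_of_hasCompactSupport hcs).abs.mul_const _) (ae_of_all _ hbound)
    _ = _ := by rw [integral_mul_const]; ring

open scoped Convolution in
theorem hasDerivAt_integral_mul_comp_sub {F φ : ℝ → ℝ} (hF : Continuous F)
    (hφ : ContDiff ℝ 1 φ) (hcs : HasCompactSupport φ) {a : ℝ} (ha : 0 < a) (t : ℝ) :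
    HasDerivAt (fun t => ∫ y, φ y * F (t - a * y))
      (a⁻¹ * ∫ y, deriv φ y * F (t - a * y)) t := by
  have hG : LocallyIntegrable (fun τ => F (a * τ)) (volume : Measure ℝ) :=
    (hF.comp (continuous_const.mul continuous_id)).locallyIntegrable
  have key := hcs.hasDerivAt_convolution_left (ContinuousLinearMap.mul ℝ ℝ) hφ hG (a⁻¹ * t)
  have hlin : HasDerivAt (fun t : ℝ => a⁻¹ * t) a⁻¹ t := by
    simpa using (hasDerivAt_id t).const_mul a⁻¹
  have := key.comp t hlin
  have hc : ∀ (ψ : ℝ → ℝ) (τ : ℝ),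
      (ψ ⋆[ContinuousLinearMap.mul ℝ ℝ, volume] fun τ => F (a * τ)) (a⁻¹ * τ)
        = ∫ y, ψ y * F (τ - a * y) := by
    intro ψ τ
    simp only [convolution, ContinuousLinearMap.mul_apply']
    congr 1 with y
    congr 2
    field_simp
  rw [hc, mul_comm] at this
  exact this.congr_of_eventuallyEq (Filter.Eventually.of_forall fun τ => (hc φ τ).symm)

theorem integral_deriv_eq_zero_of_hasCompactSupport {φ : ℝ → ℝ} (hφ : ContDiff ℝ 1 φ)
    (hcs : HasCompactSupport φ) : ∫ y, deriv φ y = 0 :=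
  integral_eq_zero_of_hasDerivAt_of_integrable
    (fun y => (hφ.differentiable one_ne_zero y).hasDerivAt)
    ((hφ.continuous_deriv le_rfl).integrable_of_hasCompactSupport hcs.deriv)
    (hφ.continuous.integrable_of_hasCompactSupport hcs)

theorem integral_deriv_mul_id_of_hasCompactSupport {φ : ℝ → ℝ} (hφ : ContDiff ℝ 1 φ)
    (hcs : HasCompactSupport φ) : ∫ y, deriv φ y * y = -∫ y, φ y := by
  have hd : ContDiff ℝ 1 (fun y => φ y * y) := hφ.mul contDiff_id
  have h := integral_deriv_eq_zero_of_hasCompactSupport hd hcs.mul_right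
  have e : deriv (fun y => φ y * y) = fun y => deriv φ y * y + φ y := by
    ext y
    simpa using ((hφ.differentiable one_ne_zero y).hasDerivAt.fun_mul (hasDerivAt_id' y)).deriv
  have hint : Integrable fun y => deriv φ y * y :=
    ((hφ.continuous_deriv le_rfl).mul continuous_id).integrable_of_hasCompactSupport
      hcs.deriv.mul_right
  rw [e, integral_add hint (hφ.continuous.integrable_of_hasCompactSupport hcs)] at h
  linarith

theorem deriv_eq_zero_of_notMem_Icc {φ : ℝ → ℝ} {p q : ℝ} (h : ∀ y, y ∉ Icc p q → φ y = 0) :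
    ∀ y, y ∉ Icc p q → deriv φ y = 0 := by
  intro y hy
  have : φ =ᶠ[nhds y] fun _ => 0 :=
    Filter.eventually_of_mem (isClosed_Icc.isOpen_compl.mem_nhds hy) h
  rw [this.deriv_eq, deriv_const]

/-- Comparison of the derivatives of mollifications at the scales `a` and `2 * a`. -/
theorem abs_deriv_mollification_sub_two_mul_le {φ : ℝ → ℝ} (hφ : ContDiff ℝ 1 φ) {L : ℝ}
    (hL : 0 < L) (hsupp : ∀ y, y ∉ Icc 0 L → φ y = 0) :
    ∃ C : ℝ, 0 ≤ C ∧ ∀ (F : ℝ → ℝ) (c Z a t : ℝ), 0 ≤ Z → Continuous F →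
      (∀ m h : ℝ, 0 < h → m + h ≤ c → |F (m + h) + F (m - h) - 2 * F m| ≤ Z * h) →
      0 < a → t ≤ c →
      |a⁻¹ * (∫ y, deriv φ y * F (t - a * y))
        - (2 * a)⁻¹ * ∫ y, deriv φ y * F (t - 2 * a * y)| ≤ C * Z := by
  have hcs : HasCompactSupport φ := HasCompactSupport.intro isCompact_Icc hsupp
  have hψ : Continuous (deriv φ) := hφ.continuous_deriv le_rfl
  have hψs := deriv_eq_zero_of_notMem_Icc hsupp
  have hψs2 : ∀ y, y ∉ Icc 0 (2 * L) → deriv φ (2⁻¹ * y) = 0 := by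
    intro y hy
    refine hψs _ fun h => hy ⟨?_, ?_⟩ <;> linarith [h.1, h.2]
  have hcs2 : HasCompactSupport (fun y => deriv φ (2⁻¹ * y)) :=
    HasCompactSupport.intro isCompact_Icc hψs2
  have hψ2 : Continuous (fun y => deriv φ (2⁻¹ * y)) := by fun_prop
  have hint : ∀ G : ℝ → ℝ, Continuous G → Integrable (fun y => deriv φ y * G y) := fun G hG =>
    (hψ.mul hG).integrable_of_hasCompactSupport hcs.deriv.mul_right
  have hint2 : ∀ G : ℝ → ℝ, Continuous G →
      Integrable (fun y => deriv φ (2⁻¹ * y) * G y) := fun G hG =>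
    (hψ2.mul hG).integrable_of_hasCompactSupport hcs2.mul_right
  have hscale : ∀ G : ℝ → ℝ, ∫ y, deriv φ (2⁻¹ * y) * G y = 2 * ∫ y, deriv φ y * G (2 * y) := by
    intro G
    have := Measure.integral_comp_mul_left (fun y => deriv φ y * G (2 * y)) (2⁻¹ : ℝ)
    simpa using this
  set χ : ℝ → ℝ := fun y => deriv φ y - 4⁻¹ * deriv φ (2⁻¹ * y) with hχdef
  have hsplit : ∀ G : ℝ → ℝ, Continuous G → ∫ y, χ y * G y
      = (∫ y, deriv φ y * G y) - 2⁻¹ * ∫ y, deriv φ y * G (2 * y) := by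
    intro G hG
    simp only [hχdef, sub_mul, mul_assoc]
    rw [integral_sub (hint G hG) ((hint2 G hG).const_mul _), integral_const_mul, hscale]
    ring
  refine ⟨2 * L * ∫ y, |χ y|, by positivity, fun F c Z a t hZ hF hzyg ha ht => ?_⟩
  have hmain := abs_integral_mul_comp_le_of_zygmund (L := 2 * L) (χ := χ) hZ (by positivity) hF
    hzyg (by fun_prop)
    (fun y hy => by
      simp only [hχdef]
      rw [hψs2 y hy, hψs y fun h => hy ⟨h.1, by linarith [h.2]⟩]
      simp)
    (by
      have := hsplit (fun _ => 1) continuous_const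
      simpa [integral_deriv_eq_zero_of_hasCompactSupport hφ hcs] using this)
    (by
      rw [hsplit (fun y => y) continuous_id]
      have e : (fun y => deriv φ y * (2 * y)) = fun y => 2 * (deriv φ y * y) := by ext y; ring
      rw [e, integral_const_mul]
      ring)
    ha ht
  rw [hsplit (fun y => F (t - a * y)) (by fun_prop)] at hmain
  have e : a⁻¹ * (∫ y, deriv φ y * F (t - a * y))
        - (2 * a)⁻¹ * (∫ y, deriv φ y * F (t - 2 * a * y))
      = a⁻¹ * ((∫ y, deriv φ y * F (t - a * y))
        - 2⁻¹ * ∫ y, deriv φ y * F (t - a * (2 * y))) := by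
    have e2 : ∀ y, t - a * (2 * y) = t - 2 * a * y := fun y => by ring
    simp_rw [e2]
    field_simp
  rw [e, abs_mul, abs_of_pos (inv_pos.2 ha)]
  calc _ ≤ a⁻¹ * ((2 * L * ∫ y, |χ y|) * (a * Z)) :=
        mul_le_mul_of_nonneg_left hmain (inv_pos.2 ha).le
    _ = _ := by field_simp

/-- Lipschitz estimate for the derivative of a mollification at scale `a`. -/
theorem abs_deriv_mollification_sub_le {φ : ℝ → ℝ} (hφ : ContDiff ℝ 2 φ) {L : ℝ}
    (hL : 0 < L) (hsupp : ∀ y, y ∉ Icc 0 L → φ y = 0) :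
    ∃ C : ℝ, 0 ≤ C ∧ ∀ (F : ℝ → ℝ) (c Z a t s : ℝ), 0 ≤ Z → Continuous F →
      (∀ m h : ℝ, 0 < h → m + h ≤ c → |F (m + h) + F (m - h) - 2 * F m| ≤ Z * h) →
      0 < a → t ≤ c → s ≤ c →
      |a⁻¹ * (∫ y, deriv φ y * F (t - a * y)) - a⁻¹ * ∫ y, deriv φ y * F (s - a * y)|
        ≤ C * Z * (|t - s| / a) := by
  have hcs : HasCompactSupport φ := HasCompactSupport.intro isCompact_Icc hsupp
  have hψ : ContDiff ℝ 1 (deriv φ) := by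
    have : ContDiff ℝ (1 + 1) φ := by rwa [one_add_one_eq_two]
    exact this.deriv'
  have hψs := deriv_eq_zero_of_notMem_Icc hsupp
  refine ⟨L * ∫ y, |deriv (deriv φ) y|, by positivity,
    fun F c Z a t s hZ hF hzyg ha ht hs => ?_⟩
  have hbd : ∀ τ ∈ Iic c, ‖a⁻¹ * (a⁻¹ * ∫ y, deriv (deriv φ) y * F (τ - a * y))‖
      ≤ (L * ∫ y, |deriv (deriv φ) y|) * Z / a := by
    intro τ hτ
    have := abs_integral_mul_comp_le_of_zygmund hZ hL hF hzyg (hψ.continuous_deriv le_rfl)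
      (deriv_eq_zero_of_notMem_Icc hψs)
      (integral_deriv_eq_zero_of_hasCompactSupport hψ hcs.deriv)
      (by rw [integral_deriv_mul_id_of_hasCompactSupport hψ hcs.deriv,
        integral_deriv_eq_zero_of_hasCompactSupport (hφ.of_le one_le_two) hcs, neg_zero])
      ha hτ
    rw [norm_mul, norm_mul, norm_inv, Real.norm_of_nonneg ha.le, Real.norm_eq_abs]
    calc _ ≤ a⁻¹ * (a⁻¹ * ((L * ∫ y, |deriv (deriv φ) y|) * (a * Z))) := by gcongr
      _ = _ := by field_simp
  have := (convex_Iic c).norm_image_sub_le_of_norm_hasDerivWithin_le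
    (fun τ _ => ((hasDerivAt_integral_mul_comp_sub hF hψ hcs.deriv ha τ).const_mul
      a⁻¹).hasDerivWithinAt) hbd hs ht
  rw [Real.norm_eq_abs, Real.norm_eq_abs] at this
  calc _ ≤ _ := this
    _ = _ := by ring

theorem abs_deriv_mollification_sub_le_rpow {φ : ℝ → ℝ} (hφ : ContDiff ℝ 2 φ) {L : ℝ}
    (hL : 0 < L) (hsupp : ∀ y, y ∉ Icc 0 L → φ y = 0) {β : ℝ} (hβ : β ∈ Ioc (0 : ℝ) 1) :
    ∃ C : ℝ, 0 ≤ C ∧ ∀ (F : ℝ → ℝ) (c Z a t s : ℝ), 0 ≤ Z → Continuous F →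
      (∀ m h : ℝ, 0 < h → m + h ≤ c → |F (m + h) + F (m - h) - 2 * F m| ≤ Z * h) →
      0 < a → t ≤ c → s ≤ c →
      |a⁻¹ * (∫ y, deriv φ y * F (t - a * y)) - a⁻¹ * ∫ y, deriv φ y * F (s - a * y)|
        ≤ C * Z * (|t - s| / a) ^ β := by
  obtain ⟨C₁, hC₁, H₁⟩ := abs_deriv_mollification_sub_two_mul_le (hφ.of_le one_le_two) hL hsupp
  obtain ⟨C₂, hC₂, H₂⟩ := abs_deriv_mollification_sub_le hφ hL hsupp
  have hq : (2⁻¹ : ℝ) ^ β < 1 := Real.rpow_lt_one (by norm_num) (by norm_num) hβ.1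
  set q : ℝ := (2⁻¹ : ℝ) ^ β with hqdef
  have hq' : 0 < 1 - q := by linarith
  have hK : 0 ≤ 2 * C₁ / (1 - q) := by positivity
  have hKeq : 2 * C₁ / (1 - q) * (1 - q) = 2 * C₁ := by field_simp
  set K := C₂ + 2 * C₁ / (1 - q) with hKdef
  refine ⟨K, by positivity, fun F c Z a t s hZ hF hzyg ha ht hs => ?_⟩
  have base : ∀ a : ℝ, 0 < a → |t - s| ≤ a →
      |a⁻¹ * (∫ y, deriv φ y * F (t - a * y)) - a⁻¹ * ∫ y, deriv φ y * F (s - a * y)|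
        ≤ K * Z * (|t - s| / a) ^ β := by
    intro a ha hts
    have hr : |t - s| / a ≤ 1 := by rwa [div_le_one ha]
    have hr0 : 0 ≤ |t - s| / a := by positivity
    have hpow : |t - s| / a ≤ (|t - s| / a) ^ β := by
      simpa using Real.rpow_le_rpow_of_exponent_ge' hr0 hr hβ.1.le hβ.2
    calc _ ≤ C₂ * Z * (|t - s| / a) := H₂ F c Z a t s hZ hF hzyg ha ht hs
      _ ≤ K * Z * (|t - s| / a) ^ β := by
        have : C₂ ≤ K := by linarith
        gcongr
  have step : ∀ (n : ℕ) (a : ℝ), 0 < a → |t - s| ≤ 2 ^ n * a →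
      |a⁻¹ * (∫ y, deriv φ y * F (t - a * y)) - a⁻¹ * ∫ y, deriv φ y * F (s - a * y)|
        ≤ K * Z * (|t - s| / a) ^ β := by
    intro n
    induction n with
    | zero => exact fun a ha hts => base a ha (by simpa using hts)
    | succ n ih =>
      intro a ha hts
      rcases le_or_gt |t - s| a with hle | hgt
      · exact base a ha hle
      have h2 := ih (2 * a) (by positivity) (by rw [pow_succ] at hts; linarith)
      have ht' := H₁ F c Z a t hZ hF hzyg ha ht
      have hs' := H₁ F c Z a s hZ hF hzyg ha hs
      have hr1 : 1 ≤ (|t - s| / a) ^ β :=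
        Real.one_le_rpow ((one_le_div ha).2 hgt.le) hβ.1.le
      have hhalf : (|t - s| / (2 * a)) ^ β = q * (|t - s| / a) ^ β := by
        rw [hqdef, ← Real.mul_rpow (by norm_num) (by positivity)]
        congr 1
        field_simp
      rw [hhalf] at h2
      have hKq : 2 * C₁ + K * q ≤ K := by
        have := mul_nonneg hC₂ hq'.le
        have e : K * (1 - q) = C₂ * (1 - q) + 2 * C₁ := by rw [hKdef, add_mul, hKeq]
        linarith
      have hsum : 2 * C₁ * Z * 1 + K * Z * (q * (|t - s| / a) ^ β)
          ≤ K * Z * (|t - s| / a) ^ β := by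
        calc _ ≤ 2 * C₁ * Z * (|t - s| / a) ^ β + K * Z * (q * (|t - s| / a) ^ β) := by gcongr
          _ = (2 * C₁ + K * q) * (Z * (|t - s| / a) ^ β) := by ring
          _ ≤ K * (Z * (|t - s| / a) ^ β) := by gcongr
          _ = _ := by ring
      rw [abs_le] at h2 ht' hs' ⊢
      constructor <;> linarith [h2.1, h2.2, ht'.1, ht'.2, hs'.1, hs'.2]
  obtain ⟨n, hn⟩ := pow_unbounded_of_one_lt (|t - s| / a) one_lt_two
  exact step n a ha ((div_le_iff₀ ha).1 hn.le)

/-- Lemma 5.2: the Hölder-in-time estimate for `∂_t u^{(R)}`, where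
`u^{(R)}` is the mollification of `u` in time. -/
theorem statement16 (d : ℕ) (hd : 1 ≤ d) (σ : ℝ) (hσ : σ ∈ Ioo (0 : ℝ) 2)
    (β : ℝ) (hβ : β ∈ Ioc (0 : ℝ) 1)
    -- the mollifier η: smooth, even, nonnegative, unit integral, supported in (-1,1)
    (η : ℝ → ℝ) (hηs : ContDiff ℝ (⊤ : ℕ∞) η) (hηe : ∀ s : ℝ, η (-s) = η s)
    (hηnn : ∀ s : ℝ, 0 ≤ η s) (hηi : (∫ s : ℝ, η s) = 1)
    (hηsupp : ∀ s : ℝ, s ∉ Ioo (-1 : ℝ) 1 → η s = 0) :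
    ∃ C : ℝ, 0 < C ∧
      ∀ R : ℝ, 0 < R →
      ∀ (u : ℝ × E d → ℝ) (Z : ℝ),
        -- u is bounded and continuous on ℝ₀^{d+1}
        ContinuousOn u (lowerHalf d) →
        (∃ M : ℝ, ∀ z ∈ lowerHalf d, |u z| ≤ M) →
        -- [u]^t_{Λ¹} ≤ Z
        (∀ (t : ℝ) (x : E d) (h : ℝ), 0 < h → t + h < 0 →
          |u (t + h, x) + u (t - h, x) - 2 * u (t, x)| ≤ Z * h) →
        -- conclusion: [∂_t u^{(R)}]^t_{β;ℝ₀^{d+1}} ≤ C R^{-βσ} Z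
        ∀ (t s : ℝ) (x : E d), t < 0 → s < 0 →
          |ut (tmoll σ R η u) (t, x) - ut (tmoll σ R η u) (s, x)|
            ≤ C * R ^ (-(β * σ)) * Z * |t - s| ^ β := by
  set φ : ℝ → ℝ := fun s => η (s - 1) with hφdef
  have hφtop : ContDiff ℝ (⊤ : ℕ∞) φ := hηs.comp (contDiff_id.sub contDiff_const)
  have hφ : ContDiff ℝ 2 φ := contDiff_infty.1 hφtop 2
  have hsupp : ∀ y, y ∉ Icc (0 : ℝ) 2 → φ y = 0 := fun y hy =>
    hηsupp _ fun h => hy ⟨by linarith [h.1], by linarith [h.2]⟩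
  have hcs : HasCompactSupport φ := HasCompactSupport.intro isCompact_Icc hsupp
  obtain ⟨K, hK, H⟩ := abs_deriv_mollification_sub_le_rpow hφ two_pos hsupp hβ
  refine ⟨3 * K + 1, by positivity, fun R hR u Z hu _ hzyg t s x ht hs => ?_⟩
  have hZ : 0 ≤ Z := by
    have := (abs_nonneg _).trans (hzyg (-2) x 1 one_pos (by norm_num))
    linarith
  have ha : 0 < R ^ σ := Real.rpow_pos_of_pos hR σ
  set a := R ^ σ with hadef
  set c := max t s / 2 with hc
  have hm : max t s < 0 := max_lt ht hs
  have hc0 : c < 0 := by rw [hc]; linarith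
  have htc : t < c := by have := le_max_left t s; rw [hc]; linarith
  have hsc : s < c := by have := le_max_right t s; rw [hc]; linarith
  set F : ℝ → ℝ := fun τ => u (min τ c, x) with hFdef
  have hF : Continuous F :=
    hu.comp_continuous (by fun_prop) fun τ => ⟨(min_le_right τ c).trans_lt hc0, mem_univ _⟩
  have hFeq : ∀ τ, τ ≤ c → F τ = u (τ, x) := fun τ h => by simp only [hFdef, min_eq_left h]
  have hFz : ∀ m h : ℝ, 0 < h → m + h ≤ c → |F (m + h) + F (m - h) - 2 * F m| ≤ Z * h := by
    intro m h hh hmc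
    rw [hFeq _ hmc, hFeq _ (by linarith), hFeq _ (by linarith)]
    exact hzyg m x h hh (by linarith)
  have hint : ∀ G : ℝ → ℝ, Continuous G → Integrable (fun y => φ y * G y) := fun G hG =>
    (hφ.continuous.mul hG).integrable_of_hasCompactSupport hcs.mul_right
  have hmoll : ∀ τ, τ < c → tmoll σ R η u (τ, x)
      = 2 * (∫ y, φ y * F (τ - a * y)) - ∫ y, φ y * F (τ - 2 * a * y) := by
    intro τ hτ
    rw [← integral_const_mul, ← integral_sub ((hint _ (by fun_prop)).const_mul _)
      (hint _ (by fun_prop))]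
    refine integral_congr_ae (ae_of_all _ fun y => ?_)
    change (2 * u (τ - a * y, x) - u (τ - 2 * a * y, x)) * φ y = _
    by_cases hy : y ∈ Icc (0 : ℝ) 2
    · have := mul_nonneg ha.le hy.1
      simp only []
      rw [hFeq _ (by linarith), hFeq _ (by linarith)]
      ring
    · simp [hsupp y hy]
  have hut : ∀ τ, τ < c → ut (tmoll σ R η u) (τ, x)
      = 2 * (a⁻¹ * ∫ y, deriv φ y * F (τ - a * y))
        - (2 * a)⁻¹ * ∫ y, deriv φ y * F (τ - 2 * a * y) := by
    intro τ hτ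
    have hev : (fun r => tmoll σ R η u (r, x)) =ᶠ[nhds τ] fun r =>
        2 * (∫ y, φ y * F (r - a * y)) - ∫ y, φ y * F (r - 2 * a * y) :=
      Filter.eventually_of_mem (Iio_mem_nhds hτ) hmoll
    have h1 := hasDerivAt_integral_mul_comp_sub hF (hφ.of_le one_le_two) hcs ha τ
    have h2 := hasDerivAt_integral_mul_comp_sub hF (hφ.of_le one_le_two) hcs
      (mul_pos two_pos ha) τ
    exact hev.deriv_eq.trans ((h1.const_mul 2).sub h2).deriv
  rw [hut t htc, hut s hsc]
  have b1 := H F c Z a t s hZ hF hFz ha htc.le hsc.le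
  have b2 := H F c Z (2 * a) t s hZ hF hFz (mul_pos two_pos ha) htc.le hsc.le
  have b3 : (|t - s| / (2 * a)) ^ β ≤ (|t - s| / a) ^ β := by
    have := hβ.1.le
    gcongr
    linarith
  have b4 := mul_le_mul_of_nonneg_left b3 (mul_nonneg hK hZ)
  have hpow : (|t - s| / a) ^ β = R ^ (-(β * σ)) * |t - s| ^ β := by
    rw [Real.div_rpow (abs_nonneg _) ha.le, hadef, ← Real.rpow_mul hR.le, Real.rpow_neg hR.le,
      mul_comm σ β, div_eq_inv_mul]
  have hnn : 0 ≤ Z * (|t - s| / a) ^ β := by positivity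
  calc _ ≤ 3 * K * (Z * (|t - s| / a) ^ β) := by
        rw [abs_le] at b1 b2 ⊢
        constructor <;> linarith [b1.1, b1.2, b2.1, b2.2]
    _ ≤ (3 * K + 1) * (Z * (|t - s| / a) ^ β) := by linarith
    _ = _ := by rw [hpow]; ring
end
end

section
/- Let σ ∈ (1,2), α ∈ (0,1), and R > 0. Let u be defined on ℝ₀^{d+1}, differentiable in x and smooth enough that the quantities below are defined, with finite seminorms [u]^*_σ (i.e. Du is C^{σ−1} in x uniformly in t), [u]^t_{Λ¹} (u is Zygmund-Λ¹ in t), and [Du]^t_{(σ−1)/σ} (Du is C^{(σ−1)/σ} in t uniformly in x). Let η be a smooth even nonnegative function on ℝ with unit integral vanishing outside (−1,1), define u^{(R)}(t,x) = ∫_ℝ (2u(t − R^σ s, x) − u(t − 2R^σ s, x)) η(s−1) ds, and let p(t,x) = u^{(R)}(0,0) + t·∂_t u^{(R)}(0,0) + x·D_x u^{(R)}(0,0) be the first-order Taylor expansion of u^{(R)} at the origin. Then for every integer j ≥ 0: [u − p]^*_{α; (−R^σ,0)×B_{2^j R}} ≤ C(2^j R)^{σ−α}[u]^*_σ + C 2^{(1−α)j}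 R^{σ−α} [Du]^t_{(σ−1)/σ} + C 2^{−jα} R^{σ−α} [u]^t_{Λ¹}, and [u − p]^t_{α/σ; (−R^σ,0)×B_{2^j R}} ≤ C 2^{j(σ−α/2)} R^{σ−α} [u]^*_σ + C 2^{j(σ+1−α)/2} R^{σ−α} [Du]^t_{(σ−1)/σ} + C 2^{j(σ−α/2)} R^{σ−α} [u]^t_{Λ¹}, where C > 0 depends only on d, σ, α, and η. -/
open MeasureTheory Set Metric ENNReal
open scoped Classical
noncomputable section

open MeasureTheory Set Metric ENNReal Nonlocal

namespace Nonlocal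

/-- A smooth even nonnegative function with unit integral vanishing outside `(-1, 1)`. -/
structure IsEvenMollifier (η : ℝ → ℝ) : Prop where
  contDiff : ContDiff ℝ (⊤ : ℕ∞) η
  even : ∀ s, η (-s) = η s
  nonneg : ∀ s, 0 ≤ η s
  integral_eq_one : ∫ s, η s = 1
  eq_zero : ∀ s, s ∉ Ioo (-1 : ℝ) 1 → η s = 0

/-- Continuity on the negative half line with Zygmund constant `Z`. -/
structure IsZygmund (Z : ℝ) (f : ℝ → ℝ) : Prop where
  continuousOn : ContinuousOn f (Iio 0)
  bound : ∀ t h : ℝ, 0 < h → t + h < 0 → |f (t + h) + f (t - h) - 2 * f t| ≤ Z * h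

/-- The one-sided average `∫ f(t - c s) η(s - 1) ds`. -/
def pastAvg (η : ℝ → ℝ) (c : ℝ) (f : ℝ → ℝ) (t : ℝ) : ℝ :=
  ∫ s : ℝ, f (t - c * s) * η (s - 1)

namespace IsEvenMollifier

variable {η : ℝ → ℝ}

lemma hasCompactSupport (hη : IsEvenMollifier η) : HasCompactSupport η := by
  refine HasCompactSupport.of_support_subset_isCompact (K := Icc (-1) 1) isCompact_Icc ?_
  intro s hs
  by_contra h
  exact hs (hη.eq_zero s fun h' => h ⟨h'.1.le, h'.2.le⟩)

lemma shift_eq_zero (hη : IsEvenMollifier η) {s : ℝ} (hs : s ∉ Ioo (0 : ℝ) 2) :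
    η (s - 1) = 0 :=
  hη.eq_zero _ fun h => hs ⟨by linarith [h.1], by linarith [h.2]⟩

lemma integrable_shift (hη : IsEvenMollifier η) : Integrable fun s => η (s - 1) :=
  (hη.contDiff.continuous.integrable_of_hasCompactSupport hη.hasCompactSupport).comp_sub_right 1

lemma integral_shift (hη : IsEvenMollifier η) : ∫ s, η (s - 1) = 1 := by
  rw [integral_sub_right_eq_self η 1, hη.integral_eq_one]

lemma norm_integral_smul_le {F : Type*} [NormedAddCommGroup F] [NormedSpace ℝ F]
    (hη : IsEvenMollifier η) {g : ℝ → F} {B : ℝ} (hg : ∀ s ∈ Ioo (0 : ℝ) 2, ‖g s‖ ≤ B) :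
    ‖∫ s, η (s - 1) • g s‖ ≤ B := by
  have h := norm_integral_le_of_norm_le (f := fun s => η (s - 1) • g s)
    (hη.integrable_shift.mul_const B) (.of_forall fun s => ?_)
  · rwa [integral_mul_const, hη.integral_shift, one_mul] at h
  · by_cases hs : s ∈ Ioo (0 : ℝ) 2
    · rw [norm_smul, Real.norm_of_nonneg (hη.nonneg _)]
      exact mul_le_mul_of_nonneg_left (hg s hs) (hη.nonneg _)
    · simp [hη.shift_eq_zero hs]

lemma abs_integral_mul_le (hη : IsEvenMollifier η) {g : ℝ → ℝ} {B : ℝ}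
    (hg : ∀ s ∈ Ioo (0 : ℝ) 2, |g s| ≤ B) : |∫ s, g s * η (s - 1)| ≤ B := by
  simpa [mul_comm] using hη.norm_integral_smul_le (g := g) hg

lemma contDiff_deriv (hη : IsEvenMollifier η) : ContDiff ℝ (⊤ : ℕ∞) (deriv η) :=
  hη.contDiff.deriv'

lemma deriv_deriv_even (hη : IsEvenMollifier η) (s : ℝ) :
    deriv (deriv η) (-s) = deriv (deriv η) s := by
  have h1 : (fun s => deriv η (-s)) = fun s => -deriv η s := by
    funext s
    have := deriv_comp_neg η s
    simp only [hη.even] at this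
    linarith
  have h2 := deriv_comp_neg (deriv η) s
  rw [h1, deriv.fun_neg] at h2
  linarith

lemma integral_deriv_deriv (hη : IsEvenMollifier η) : ∫ s, deriv (deriv η) s = 0 := by
  have h1 := hη.contDiff_deriv
  refine integral_eq_zero_of_hasDerivAt_of_integrable (f := deriv η) (fun x =>
    ((h1.differentiable (by simp)) x).hasDerivAt) ?_ ?_
  · exact (h1.continuous_deriv (by simp)).integrable_of_hasCompactSupport
      hη.hasCompactSupport.deriv.deriv
  · exact h1.continuous.integrable_of_hasCompactSupport hη.hasCompactSupport.deriv

lemma deriv_deriv_eq_zero (hη : IsEvenMollifier η) {s : ℝ} (hs : s ∉ Icc (-1 : ℝ) 1) :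
    deriv (deriv η) s = 0 := by
  have h : tsupport η ⊆ Icc (-1) 1 := by
    refine closure_minimal (fun s hs => ?_) isClosed_Icc
    by_contra h
    exact hs (hη.eq_zero s fun h' => h ⟨h'.1.le, h'.2.le⟩)
  by_contra h0
  exact hs (h (tsupport_deriv_subset (tsupport_deriv_subset (subset_tsupport _ h0))))

end IsEvenMollifier

namespace IsZygmund

variable {η f : ℝ → ℝ} {Z : ℝ}

lemma nonneg (hf : IsZygmund Z f) : 0 ≤ Z := by
  have := (abs_nonneg _).trans (hf.bound (-2) 1 one_pos (by norm_num))
  linarith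

lemma comp_mul (hf : IsZygmund Z f) {c : ℝ} (hc : 0 < c) :
    IsZygmund (Z * c) fun t => f (c * t) where
  continuousOn := hf.continuousOn.comp (by fun_prop) fun t ht => mul_neg_of_pos_of_neg hc ht
  bound t h hh hth := by
    have := hf.bound (c * t) (c * h) (by positivity) (by nlinarith)
    rw [mul_add, mul_sub]
    linarith

lemma exists_bound (hf : IsZygmund Z f) {a : ℝ} (ha : 0 < a) :
    ∃ B, ∀ t ∈ Ioo (-a) 0, |f t| ≤ B := by
  obtain ⟨B, hB⟩ := (isCompact_Icc (a := -(2 * a)) (b := -a)).exists_bound_of_continuousOn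
    (hf.continuousOn.mono fun t ht => mem_Iio.2 (by linarith [ht.2]))
  refine ⟨Z * a + 2 * |f (-a)| + B, fun t ht => ?_⟩
  have h1 := hf.bound (-a) (t + a) (by linarith [ht.1]) (by linarith [ht.2])
  have h2 := hB (-a - (t + a)) ⟨by linarith [ht.2], by linarith [ht.1]⟩
  have h3 : Z * (t + a) ≤ Z * a := mul_le_mul_of_nonneg_left (by linarith [ht.2]) hf.nonneg
  rw [show -a + (t + a) = t by ring] at h1
  rw [Real.norm_eq_abs] at h2
  have := neg_abs_le (f (-a))
  have := le_abs_self (f (-a))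
  rw [abs_le] at h1 h2 ⊢
  constructor <;> linarith

lemma locallyIntegrable (hf : IsZygmund Z f) : LocallyIntegrable ((Iio 0).indicator f) := by
  rw [locallyIntegrable_iff]
  intro k hk
  obtain ⟨a, ha⟩ := hk.isBounded.subset_ball (0 : ℝ)
  obtain ⟨B, hB⟩ := hf.exists_bound (a := max a 1) (by positivity)
  have hsub : k ⊆ Ioo (-max a 1) (max a 1) := by
    intro t ht
    have := ha ht
    rw [mem_ball_zero_iff, Real.norm_eq_abs, abs_lt] at this
    exact ⟨by linarith [le_max_left a 1], by linarith [le_max_left a 1]⟩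
  refine IntegrableOn.mono_set ?_ hsub
  refine Measure.integrableOn_of_bounded (M := max B 0) (by simp) ?_ ?_
  · rw [aestronglyMeasurable_indicator_iff measurableSet_Iio]
    exact hf.continuousOn.aestronglyMeasurable measurableSet_Iio
  · refine (ae_restrict_mem measurableSet_Ioo).mono fun t ht => ?_
    by_cases h : t ∈ Iio (0 : ℝ)
    · rw [indicator_of_mem h]
      exact (hB t ⟨ht.1, h⟩).trans (le_max_left _ _)
    · rw [indicator_of_notMem h]
      simp

lemma integrable_indicator_mul (hf : IsZygmund Z f) {ψ : ℝ → ℝ} (hψ : Continuous ψ)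
    (hψc : HasCompactSupport ψ) (t : ℝ) :
    Integrable fun s => (Iio 0).indicator f (t - s) * ψ s := by
  have h := (hψc.convolutionExists_right (ContinuousLinearMap.mul ℝ ℝ) hf.locallyIntegrable hψ
    t).integrable.comp_sub_left t
  simpa using h

lemma indicator_mul_shift (hη : IsEvenMollifier η) (f : ℝ → ℝ) {c t : ℝ} (hc : 0 < c)
    (ht : t ≤ 0) (s : ℝ) :
    (Iio 0).indicator (fun v => f (c * v)) (t / c - s) * η (s - 1) =
      f (t - c * s) * η (s - 1) := by
  by_cases hs : s ∈ Ioo (0 : ℝ) 2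
  · have h1 : t / c ≤ 0 := div_nonpos_of_nonpos_of_nonneg ht hc.le
    have h2 : t / c - s ∈ Iio (0 : ℝ) := mem_Iio.2 (by linarith [hs.1])
    rw [indicator_of_mem h2, mul_sub, mul_div_cancel₀ _ hc.ne']
  · simp [hη.shift_eq_zero hs]

lemma integrable_pastAvg (hη : IsEvenMollifier η) (hf : IsZygmund Z f) {c t : ℝ} (hc : 0 < c)
    (ht : t ≤ 0) : Integrable fun s => f (t - c * s) * η (s - 1) := by
  have h := (hf.comp_mul hc).integrable_indicator_mul (ψ := fun s => η (s - 1))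
    (hη.contDiff.continuous.comp (by fun_prop))
    (hη.hasCompactSupport.comp_homeomorph (Homeomorph.subRight 1)) (t / c)
  simpa only [indicator_mul_shift hη f hc ht] using h

lemma abs_integral_deriv_deriv_le (hη : IsEvenMollifier η) (hf : IsZygmund Z f) {t : ℝ}
    (ht : t < -1) :
    |∫ s, (Iio 0).indicator f (t - s) * deriv (deriv η) s| ≤
      (∫ s, |deriv (deriv η) s|) * Z := by
  set ψ := deriv (deriv η) with hψ
  set g := (Iio 0).indicator f with hg
  have hψ1 : Continuous ψ := hη.contDiff_deriv.continuous_deriv (by simp)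
  have hψ2 : HasCompactSupport ψ := hη.hasCompactSupport.deriv.deriv
  have hψi : Integrable ψ := hψ1.integrable_of_hasCompactSupport hψ2
  have hi := hf.integrable_indicator_mul hψ1 hψ2 t
  have hi' : Integrable fun s => g (t + s) * ψ s := by
    simpa [hη.deriv_deriv_even, hψ] using hi.comp_neg
  have e1 : ∫ s, g (t + s) * ψ s = ∫ s, g (t - s) * ψ s := by
    rw [← integral_neg_eq_self]
    simp [hη.deriv_deriv_even, hψ, sub_eq_add_neg]
  have e2 : ∫ s, (g (t + s) + g (t - s) - 2 * g t) * ψ s =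
      2 * ∫ s, g (t - s) * ψ s := by
    simp only [sub_mul, add_mul]
    have h1 : ∫ s, 2 * g t * ψ s = 0 := by
      rw [integral_const_mul, hη.integral_deriv_deriv, mul_zero]
    have h2 : ∫ s, (g (t + s) * ψ s + g (t - s) * ψ s - 2 * g t * ψ s) =
        (∫ s, (g (t + s) * ψ s + g (t - s) * ψ s)) - ∫ s, 2 * g t * ψ s :=
      integral_sub (f := fun s => g (t + s) * ψ s + g (t - s) * ψ s) (hi'.add hi)
        (hψi.const_mul _)
    rw [h2, integral_add hi' hi, e1, h1]
    ring
  have e3 : |∫ s, (g (t + s) + g (t - s) - 2 * g t) * ψ s| ≤ (∫ s, |ψ s|) * Z := by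
    rw [← integral_mul_const, ← Real.norm_eq_abs]
    refine norm_integral_le_of_norm_le (hψi.abs.mul_const Z) (.of_forall fun s => ?_)
    by_cases hs : s ∈ Icc (-1 : ℝ) 1
    · rw [norm_mul, mul_comm, Real.norm_eq_abs, Real.norm_eq_abs]
      refine mul_le_mul_of_nonneg_left ?_ (abs_nonneg _)
      rw [hg, indicator_of_mem (mem_Iio.2 (by linarith [hs.2])),
        indicator_of_mem (mem_Iio.2 (by linarith [hs.1])), indicator_of_mem (mem_Iio.2 (by linarith))]
      have hZ := hf.nonneg
      rcases lt_trichotomy s 0 with h | h | h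
      · have := hf.bound t (-s) (by linarith) (by linarith [hs.1])
        rw [sub_neg_eq_add, ← sub_eq_add_neg, add_comm (f (t - s))] at this
        nlinarith [hs.1]
      · subst h
        simp [← two_mul, hZ]
      · have := hf.bound t s h (by linarith [hs.2])
        nlinarith [hs.2]
    · simp [hψ, hη.deriv_deriv_eq_zero hs]
  rw [e2, abs_mul, abs_two] at e3
  linarith [abs_nonneg (∫ s, g (t - s) * ψ s)]

/-- Past averages have a second-order Taylor estimate at `0` from the left. -/
lemma exists_pastAvg_taylor (hη : IsEvenMollifier η) (hf : IsZygmund Z f) {c : ℝ}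
    (hc : 0 < c) : ∃ q : ℝ, ∀ t ≤ 0,
      |pastAvg η c f t - pastAvg η c f 0 - t * q| ≤
        (∫ s, |deriv (deriv η) s|) * Z * t ^ 2 / c := by
  have hfc := hf.comp_mul hc
  set g := (Iio 0).indicator (fun v => f (c * v)) with hg
  set L := ContinuousLinearMap.mul ℝ ℝ
  set K := ∫ s, |deriv (deriv η) s|
  have hg' : LocallyIntegrable g := hfc.locallyIntegrable
  have d0 : ∀ v, HasDerivAt (convolution g η L) (convolution g (deriv η) L volume v) v :=
    fun v => hη.hasCompactSupport.hasDerivAt_convolution_right L hg'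
      (hη.contDiff.of_le (by exact_mod_cast le_top)) v
  have d1 : ∀ v, HasDerivAt (convolution g (deriv η) L)
      (convolution g (deriv (deriv η)) L volume v) v :=
    fun v => hη.hasCompactSupport.deriv.hasDerivAt_convolution_right L hg'
      (hη.contDiff_deriv.of_le (by exact_mod_cast le_top)) v
  have hb : ∀ v < -1, |convolution g (deriv (deriv η)) L volume v| ≤ K * (Z * c) := by
    intro v hv
    rw [convolution_eq_swap]
    exact abs_integral_deriv_deriv_le hη hfc hv
  have e : ∀ t ≤ 0, pastAvg η c f t = convolution g η L volume (t / c - 1) := by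
    intro t ht
    rw [convolution_eq_swap, pastAvg,
      ← integral_sub_right_eq_self (fun s => (L (g (t / c - 1 - s))) (η s)) 1]
    refine integral_congr_ae (.of_forall fun s => ?_)
    change f (t - c * s) * η (s - 1) = g (t / c - 1 - (s - 1)) * η (s - 1)
    rw [← indicator_mul_shift hη f hc ht, hg]
    congr 2
    ring
  refine ⟨convolution g (deriv η) L volume (-1) / c, fun t ht => ?_⟩
  rcases ht.eq_or_lt with rfl | ht'
  · simp
  rw [e t ht, e 0 le_rfl, zero_div, zero_sub]
  have hv : t / c - 1 < -1 := by linarith [div_neg_of_neg_of_pos ht' hc]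
  set v := t / c - 1 with hvdef
  obtain ⟨ξ, hξ, hξ'⟩ := exists_hasDerivAt_eq_slope _ _ hv
    (fun x _ => (d0 x).continuousAt.continuousWithinAt) (fun x _ => d0 x)
  obtain ⟨ζ, hζ, hζ'⟩ := exists_hasDerivAt_eq_slope _ _ hξ.2
    (fun x _ => (d1 x).continuousAt.continuousWithinAt) (fun x _ => d1 x)
  rw [_root_.eq_div_iff (by linarith)] at hξ'
  rw [_root_.eq_div_iff (by linarith [hξ.2])] at hζ'
  have ht2 : t = c * (v + 1) := by rw [hvdef]; field_simp; ring
  have key : convolution g η L volume v - convolution g η L volume (-1) -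
      t * (convolution g (deriv η) L volume (-1) / c) =
      (convolution g (deriv (deriv η)) L volume ζ) * ((-1 - ξ) * (-1 - v)) := by
    have : t * (convolution g (deriv η) L volume (-1) / c) =
        (v + 1) * convolution g (deriv η) L volume (-1) := by
      rw [ht2]; field_simp
    rw [this]
    linear_combination hξ' + (v + 1) * hζ'
  have hpos : 0 ≤ (-1 - ξ) * (-1 - v) := mul_nonneg (by linarith [hξ.2]) (by linarith)
  rw [key, abs_mul, abs_of_nonneg hpos]
  have hK : 0 ≤ K * (Z * c) := (abs_nonneg _).trans (hb ζ hζ.2)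
  calc _ ≤ K * (Z * c) * ((-1 - v) * (-1 - v)) :=
        mul_le_mul (hb ζ hζ.2) (mul_le_mul_of_nonneg_right (by linarith [hξ.1]) (by linarith))
          hpos hK
    _ = K * Z * t ^ 2 / c := by rw [ht2]; field_simp; ring

end IsZygmund

/-- A bounded Zygmund function is Hölder of every exponent `β < 1`. -/
lemma IsZygmund.abs_sub_le {g : ℝ → ℝ} {Z M r β : ℝ} (hg : IsZygmund Z g) (hr : 0 < r)
    (hβ : β ∈ Ioo (0 : ℝ) 1) (hM : ∀ t ∈ Ioo (-(4 * r)) 0, |g t| ≤ M) {t s : ℝ}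
    (ht : t ∈ Ioo (-r) 0) (hs : s ∈ Ioo (-r) 0) :
    |g t - g s| ≤ (2 * M + Z * r / (1 - 2 ^ (β - 1))) * (|t - s| / r) ^ β := by
  set K := 2 * M + Z * r / (1 - 2 ^ (β - 1)) with hK
  have hZ := hg.nonneg
  have hM0 : 0 ≤ M := (abs_nonneg _).trans (hM t ⟨by linarith [ht.1], ht.2⟩)
  have hp1 : (2 : ℝ) ^ (β - 1) < 1 :=
    Real.rpow_lt_one_of_one_lt_of_neg one_lt_two (by linarith [hβ.2])
  have hp2 : (2 : ℝ) ^ β = 2 * 2 ^ (β - 1) := by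
    rw [Real.rpow_sub_one two_ne_zero]; ring
  have hK2 : Z * r / 2 ≤ K * (1 - 2 ^ (β - 1)) := by
    rw [hK, add_mul, div_mul_cancel₀ _ (by linarith)]
    have : 0 ≤ M * (1 - 2 ^ (β - 1)) := mul_nonneg hM0 (by linarith)
    have : 0 ≤ Z * r := by positivity
    linarith
  have hKM : 2 * M ≤ K := by
    have : 0 ≤ Z * r / (1 - 2 ^ (β - 1)) := div_nonneg (by positivity) (by linarith)
    linarith
  have hmain : ∀ n : ℕ, ∀ t ∈ Ioo (-r) 0, ∀ h : ℝ, 0 < h → r < 2 ^ n * h → h ≤ 2 * r →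
      |g t - g (t - h)| ≤ K * (h / r) ^ β := by
    intro n
    induction n with
    | zero =>
      intro t ht h hh hrh hhr
      rw [pow_zero, one_mul] at hrh
      have h1 : 1 ≤ (h / r) ^ β := Real.one_le_rpow ((one_le_div hr).2 hrh.le) hβ.1.le
      have h2 := hM t ⟨by linarith [ht.1], ht.2⟩
      have h3 := hM (t - h) ⟨by linarith [ht.1], by linarith [ht.2]⟩
      calc |g t - g (t - h)| ≤ 2 * M := by
            rw [abs_le] at *; constructor <;> linarith
        _ ≤ K := hKM
        _ ≤ _ := le_mul_of_one_le_right (by linarith) h1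
    | succ n ih =>
      intro t ht h hh hrh hhr
      by_cases hcase : r < 2 ^ n * h
      · exact ih t ht h hh hcase hhr
      have hle : h ≤ r := by
        have : (1 : ℝ) ≤ 2 ^ n := one_le_pow₀ one_le_two
        nlinarith
      have h1 := ih t ht (2 * h) (by positivity) (by rw [pow_succ] at hrh; linarith) (by linarith)
      have h2 := hg.bound (t - h) h hh (by linarith [ht.2])
      rw [sub_add_cancel, sub_sub, ← two_mul] at h2
      rw [mul_div_assoc, Real.mul_rpow two_pos.le (by positivity), hp2] at h1
      have h3 : h / r ≤ (h / r) ^ β := by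
        have := Real.rpow_le_rpow_of_exponent_ge (x := h / r) (by positivity)
          ((div_le_one hr).2 hle) hβ.2.le
        rwa [Real.rpow_one] at this
      have h4 : Z * h / 2 ≤ Z * r / 2 * (h / r) ^ β := by
        calc Z * h / 2 = Z * r / 2 * (h / r) := by field_simp
          _ ≤ _ := mul_le_mul_of_nonneg_left h3 (by positivity)
      have h5 : Z * r / 2 * (h / r) ^ β ≤ K * (1 - 2 ^ (β - 1)) * (h / r) ^ β :=
        mul_le_mul_of_nonneg_right hK2 (by positivity)
      rw [abs_le] at h1 h2 ⊢
      constructor <;> linarith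
  have hlt : ∀ t ∈ Ioo (-r) 0, ∀ s ∈ Ioo (-r) 0, s < t →
      |g t - g s| ≤ K * (|t - s| / r) ^ β := by
    intro t ht s hs hst
    obtain ⟨n, hn⟩ := pow_unbounded_of_one_lt (r / (t - s)) one_lt_two
    have := hmain n t ht (t - s) (by linarith) ((div_lt_iff₀ (by linarith)).1 hn)
      (by linarith [ht.2, hs.1])
    rwa [_root_.sub_sub_cancel, ← abs_of_pos (sub_pos.2 hst)] at this
  rcases lt_trichotomy s t with h | h | h
  · exact hlt t ht s hs h
  · subst h
    simp [Real.zero_rpow hβ.1.ne']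
  · rw [abs_sub_comm, abs_sub_comm t s]
    exact hlt s hs t ht h

lemma IsEvenMollifier.integrable_smul {η : ℝ → ℝ} {F : Type*} [NormedAddCommGroup F]
    [NormedSpace ℝ F] (hη : IsEvenMollifier η) {g : ℝ → F} (hg : ContinuousOn g (Ioi 0)) {B : ℝ}
    (hB : ∀ s ∈ Ioo (0 : ℝ) 2, ‖g s‖ ≤ B) : Integrable fun s => η (s - 1) • g s := by
  refine (hη.integrable_shift.mul_const B).mono' ?_ (.of_forall fun s => ?_)
  · have h : (fun s => η (s - 1) • g s) = (Ioi 0).indicator fun s => η (s - 1) • g s := by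
      refine (indicator_eq_self.2 fun s hs => ?_).symm
      by_contra h
      exact hs (by simp [hη.shift_eq_zero fun h' : s ∈ Ioo (0 : ℝ) 2 => h h'.1])
    rw [h, aestronglyMeasurable_indicator_iff measurableSet_Ioi]
    refine ContinuousOn.aestronglyMeasurable (ContinuousOn.smul ?_ hg) measurableSet_Ioi
    exact (hη.contDiff.continuous.comp (continuous_id.sub continuous_const)).continuousOn
  · by_cases hs : s ∈ Ioo (0 : ℝ) 2
    · rw [norm_smul, Real.norm_of_nonneg (hη.nonneg _)]
      exact mul_le_mul_of_nonneg_left (hB s hs) (hη.nonneg _)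
    · simp [hη.shift_eq_zero hs]

/-- The regularity class on the lower half space: `[u]^*_σ ≤ S`, `[u]^t_{Λ¹} ≤ Z` and
`[Du]^t_{(σ-1)/σ} ≤ D`. -/
structure IsParabolicHolder (σ S Z D : ℝ) (u : ℝ × E d → ℝ) : Prop where
  continuousOn : ContinuousOn u (lowerHalf d)
  differentiableAt : ∀ z ∈ lowerHalf d, DifferentiableAt ℝ (fun x => u (z.1, x)) z.2
  du_space : ∀ t : ℝ, t < 0 → ∀ x y : E d,
    ‖Du u (t, x) - Du u (t, y)‖ ≤ S * ‖x - y‖ ^ (σ - 1)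
  zygmund : ∀ (t : ℝ) (x : E d) (h : ℝ), 0 < h → t + h < 0 →
    |u (t + h, x) + u (t - h, x) - 2 * u (t, x)| ≤ Z * h
  du_time : ∀ t s : ℝ, t < 0 → s < 0 → ∀ x : E d,
    ‖Du u (t, x) - Du u (s, x)‖ ≤ D * |t - s| ^ ((σ - 1) / σ)

namespace IsParabolicHolder

variable {σ S Z D R : ℝ} {u : ℝ × E d → ℝ} {η : ℝ → ℝ}

lemma isZygmund (hu : IsParabolicHolder σ S Z D u) (x : E d) :
    IsZygmund Z fun t => u (t, x) where
  continuousOn := hu.continuousOn.comp (by fun_prop) fun _ ht => ⟨ht, mem_univ _⟩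
  bound t h hh hth := hu.zygmund t x h hh hth

lemma differentiableAt_slice (hu : IsParabolicHolder σ S Z D u) {t : ℝ} (ht : t < 0) (x : E d) :
    DifferentiableAt ℝ (fun x => u (t, x)) x :=
  hu.differentiableAt (t, x) ⟨ht, mem_univ _⟩

lemma time_nonneg (hu : IsParabolicHolder σ S Z D u) : 0 ≤ D := by
  have := (norm_nonneg _).trans (hu.du_time (-1) (-2) (by norm_num) (by norm_num) 0)
  norm_num at this
  exact this

lemma space_nonneg (hd : 1 ≤ d) (hu : IsParabolicHolder σ S Z D u) : 0 ≤ S := by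
  have := (norm_nonneg _).trans
    (hu.du_space (-1) (by norm_num) (EuclideanSpace.single ⟨0, hd⟩ 1) 0)
  simpa using this

lemma tmoll_eq (hη : IsEvenMollifier η) (hu : IsParabolicHolder σ S Z D u) (hR : 0 < R)
    {t : ℝ} (ht : t ≤ 0) (x : E d) :
    tmoll σ R η u (t, x) = 2 * pastAvg η (R ^ σ) (fun t => u (t, x)) t -
      pastAvg η (2 * R ^ σ) (fun t => u (t, x)) t := by
  have hr : 0 < R ^ σ := Real.rpow_pos_of_pos hR σ
  have h1 := (hu.isZygmund x).integrable_pastAvg hη hr ht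
  have h2 := (hu.isZygmund x).integrable_pastAvg hη (c := 2 * R ^ σ) (by positivity) ht
  rw [pastAvg, pastAvg, ← integral_const_mul, ← integral_sub (h1.const_mul 2) h2, tmoll]
  congr 1
  funext s
  ring

lemma abs_sub_tmoll_le (hη : IsEvenMollifier η) (hu : IsParabolicHolder σ S Z D u) (hR : 0 < R)
    {t : ℝ} (ht : t < 0) (x : E d) :
    |u (t, x) - tmoll σ R η u (t, x)| ≤ 2 * Z * R ^ σ := by
  have hr : 0 < R ^ σ := Real.rpow_pos_of_pos hR σ
  have hZ := (hu.isZygmund x).nonneg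
  have h1 := (hu.isZygmund x).integrable_pastAvg hη hr ht.le
  have h2 := (hu.isZygmund x).integrable_pastAvg hη (c := 2 * R ^ σ) (by positivity) ht.le
  have e : u (t, x) - tmoll σ R η u (t, x) =
      ∫ s, (u (t, x) + u (t - 2 * R ^ σ * s, x) - 2 * u (t - R ^ σ * s, x)) * η (s - 1) := by
    have e1 : u (t, x) = ∫ s, u (t, x) * η (s - 1) := by
      rw [integral_const_mul, hη.integral_shift, mul_one]
    rw [tmoll_eq hη hu hR ht.le]
    nth_rewrite 1 [e1]
    rw [pastAvg, pastAvg, ← integral_const_mul, ← integral_sub (h1.const_mul 2) h2,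
      ← integral_sub
        (g := fun s => 2 * (u (t - R ^ σ * s, x) * η (s - 1)) - u (t - 2 * R ^ σ * s, x) * η (s - 1))
        (hη.integrable_shift.const_mul _) ((h1.const_mul 2).sub h2)]
    congr 1
    funext s
    ring
  rw [e]
  refine hη.abs_integral_mul_le fun s hs => ?_
  have h3 := hu.zygmund (t - R ^ σ * s) x (R ^ σ * s) (mul_pos hr hs.1) (by linarith)
  rw [sub_add_cancel, sub_sub, ← two_mul, ← mul_assoc] at h3
  refine h3.trans ?_
  have : R ^ σ * s ≤ R ^ σ * 2 := mul_le_mul_of_nonneg_left hs.2.le hr.le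
  nlinarith

lemma exists_tmoll_taylor (hη : IsEvenMollifier η) (hu : IsParabolicHolder σ S Z D u)
    (hR : 0 < R) (x : E d) :
    ∃ q : ℝ, ∀ t ≤ 0, |tmoll σ R η u (t, x) - tmoll σ R η u (0, x) - t * q| ≤
      3 * (∫ s, |deriv (deriv η) s|) * Z * t ^ 2 / R ^ σ := by
  have hr : 0 < R ^ σ := Real.rpow_pos_of_pos hR σ
  have hZ := (hu.isZygmund x).nonneg
  obtain ⟨q₁, h₁⟩ := (hu.isZygmund x).exists_pastAvg_taylor hη hr
  obtain ⟨q₂, h₂⟩ := (hu.isZygmund x).exists_pastAvg_taylor hη (c := 2 * R ^ σ) (by positivity)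
  refine ⟨2 * q₁ - q₂, fun t ht => ?_⟩
  rw [tmoll_eq hη hu hR ht, tmoll_eq hη hu hR le_rfl]
  have a₁ := h₁ t ht
  have a₂ := h₂ t ht
  set A := (∫ s, |deriv (deriv η) s|) * Z * t ^ 2 / R ^ σ with hA
  have hA0 : 0 ≤ A := by
    have : 0 ≤ ∫ s, |deriv (deriv η) s| := integral_nonneg fun _ => abs_nonneg _
    positivity
  have e₂ : (∫ s, |deriv (deriv η) s|) * Z * t ^ 2 / (2 * R ^ σ) = A / 2 := by
    rw [hA]; field_simp
  have e₃ : 3 * (∫ s, |deriv (deriv η) s|) * Z * t ^ 2 / R ^ σ = 3 * A := by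
    rw [hA]; ring
  rw [e₂] at a₂
  rw [e₃]
  rw [abs_le] at *
  constructor <;> linarith

lemma _root_.derivWithin_Iio_eq_of_quadratic {F : ℝ → ℝ} {q A : ℝ}
    (h : ∀ t ≤ 0, |F t - F 0 - t * q| ≤ A * t ^ 2) : derivWithin F (Iio 0) 0 = q := by
  refine HasDerivWithinAt.derivWithin ?_ (uniqueDiffWithinAt_Iio 0)
  rw [hasDerivWithinAt_iff_isLittleO]
  refine Asymptotics.IsBigO.trans_isLittleO (g := fun t : ℝ => t ^ 2) ?_ ?_
  · refine Asymptotics.IsBigO.of_bound A ?_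
    filter_upwards [self_mem_nhdsWithin] with t ht
    simpa using h t (le_of_lt ht)
  · simp only [sub_zero]
    exact ((Asymptotics.isLittleO_pow_id one_lt_two).mono nhdsWithin_le_nhds)

lemma abs_pastAvg_mixed_le (hη : IsEvenMollifier η) (hu : IsParabolicHolder σ S Z D u)
    {c T : ℝ} (hc : 0 < c) (hT : 0 < T) (x : E d) :
    |(pastAvg η c (fun t => u (t, x)) 0 - pastAvg η c (fun t => u (t, x)) (-T)) -
      (pastAvg η c (fun t => u (t, 0)) 0 - pastAvg η c (fun t => u (t, 0)) (-T))| ≤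
      D * T ^ ((σ - 1) / σ) * ‖x‖ := by
  have i := fun (x : E d) {t : ℝ} (ht : t ≤ 0) => (hu.isZygmund x).integrable_pastAvg hη hc ht
  have hT' : -T ≤ 0 := by linarith
  simp only [pastAvg]
  rw [← integral_sub (i x le_rfl) (i x hT'), ← integral_sub (i 0 le_rfl) (i 0 hT'),
    ← integral_sub (f := fun s => u (0 - c * s, x) * η (s - 1) - u (-T - c * s, x) * η (s - 1))
      (g := fun s => u (0 - c * s, 0) * η (s - 1) - u (-T - c * s, 0) * η (s - 1))
      ((i x le_rfl).sub (i x hT')) ((i 0 le_rfl).sub (i 0 hT'))]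
  simp only [← sub_mul]
  refine hη.abs_integral_mul_le fun s hs => ?_
  have ha : 0 - c * s < 0 := by nlinarith [hs.1]
  have hb : -T - c * s < 0 := by linarith
  have h := convex_univ.norm_image_sub_le_of_norm_fderiv_le (𝕜 := ℝ)
    (f := fun x => u (0 - c * s, x) - u (-T - c * s, x)) (x := (0 : E d)) (y := x)
    (C := D * T ^ ((σ - 1) / σ))
    (fun y _ => (hu.differentiableAt_slice ha y).fun_sub (hu.differentiableAt_slice hb y))
    (fun y _ => ?_) (mem_univ _) (mem_univ _)
  · simpa using h
  · rw [fderiv_fun_sub (hu.differentiableAt_slice ha y) (hu.differentiableAt_slice hb y)]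
    have := hu.du_time _ _ ha hb y
    rwa [show 0 - c * s - (-T - c * s) = T by ring, abs_of_pos hT] at this

lemma abs_tmoll_mixed_le (hη : IsEvenMollifier η) (hu : IsParabolicHolder σ S Z D u)
    (hR : 0 < R) {T : ℝ} (hT : 0 < T) (x : E d) :
    |(tmoll σ R η u (0, x) - tmoll σ R η u (-T, x)) -
      (tmoll σ R η u (0, 0) - tmoll σ R η u (-T, 0))| ≤
      3 * (D * T ^ ((σ - 1) / σ) * ‖x‖) := by
  have hr : 0 < R ^ σ := Real.rpow_pos_of_pos hR σ
  have hT' : -T ≤ 0 := by linarith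
  have h₁ := hu.abs_pastAvg_mixed_le hη hr hT x
  have h₂ := hu.abs_pastAvg_mixed_le hη (c := 2 * R ^ σ) (by positivity) hT x
  rw [tmoll_eq hη hu hR hT', tmoll_eq hη hu hR le_rfl, tmoll_eq hη hu hR hT',
    tmoll_eq hη hu hR le_rfl]
  rw [abs_le] at *
  constructor <;> linarith

lemma continuousOn_du (hσ : 1 < σ) (hu : IsParabolicHolder σ S Z D u) (x : E d) :
    ContinuousOn (fun t => Du u (t, x)) (Iio 0) := by
  intro t ht
  have hγ : 0 < (σ - 1) / σ := div_pos (by linarith) (by linarith)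
  rw [ContinuousWithinAt, tendsto_iff_norm_sub_tendsto_zero]
  refine squeeze_zero' (g := fun s => D * |s - t| ^ ((σ - 1) / σ))
    (.of_forall fun _ => norm_nonneg _) ?_ ?_
  · filter_upwards [self_mem_nhdsWithin] with s hs using hu.du_time s t hs ht x
  · have : Continuous fun s : ℝ => D * |s - t| ^ ((σ - 1) / σ) :=
      continuous_const.mul ((continuous_id.sub continuous_const).abs.rpow_const
        fun _ => Or.inr hγ.le)
    have h := (this.tendsto t).mono_left (nhdsWithin_le_nhds (s := Iio 0))
    simpa [Real.zero_rpow hγ.ne'] using h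

lemma norm_du_le (hσ : 1 < σ) (hd : 1 ≤ d) (hu : IsParabolicHolder σ S Z D u) {c s : ℝ}
    (hc : 0 < c) (hs : s ∈ Ioo (0 : ℝ) 2) {x : E d} (hx : ‖x‖ ≤ 1) :
    ‖Du u (0 - c * s, x)‖ ≤ S + D * c ^ ((σ - 1) / σ) + ‖Du u (-c, (0 : E d))‖ := by
  have hlt : 0 - c * s < 0 := by nlinarith [hs.1]
  have h1 := hu.du_space (0 - c * s) hlt x 0
  have h2 := hu.du_time (0 - c * s) (-c) hlt (by linarith) 0
  have hγ : 0 < (σ - 1) / σ := div_pos (by linarith) (by linarith)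
  have h3 : S * ‖x - 0‖ ^ (σ - 1) ≤ S :=
    mul_le_of_le_one_right (hu.space_nonneg hd)
      (Real.rpow_le_one (norm_nonneg _) (by simpa using hx) (by linarith))
  have h4 : D * |0 - c * s - -c| ^ ((σ - 1) / σ) ≤ D * c ^ ((σ - 1) / σ) := by
    refine mul_le_mul_of_nonneg_left (Real.rpow_le_rpow (abs_nonneg _) ?_ hγ.le) hu.time_nonneg
    rw [abs_le]
    constructor <;> nlinarith [hs.1, hs.2]
  have h5 : Du u (0 - c * s, x) = (Du u (0 - c * s, x) - Du u (0 - c * s, 0)) +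
      (Du u (0 - c * s, 0) - Du u (-c, 0)) + Du u (-c, 0) := by abel
  rw [h5]
  exact (norm_add₃_le).trans (by linarith)

lemma integrable_smul_du (hη : IsEvenMollifier η) (hσ : 1 < σ) (hd : 1 ≤ d)
    (hu : IsParabolicHolder σ S Z D u) {c : ℝ} (hc : 0 < c) :
    Integrable fun s => η (s - 1) • Du u (0 - c * s, (0 : E d)) := by
  refine hη.integrable_smul ((hu.continuousOn_du hσ 0).comp (by fun_prop) fun s hs => ?_)
    fun s hs => hu.norm_du_le hσ hd hc hs (by simp)
  have : 0 < c * s := mul_pos hc hs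
  exact mem_Iio.2 (by linarith)

lemma hasFDerivAt_pastAvg (hη : IsEvenMollifier η) (hσ : 1 < σ) (hd : 1 ≤ d)
    (hu : IsParabolicHolder σ S Z D u) {c : ℝ} (hc : 0 < c) :
    HasFDerivAt (fun x => pastAvg η c (fun t => u (t, x)) 0)
      (∫ s, η (s - 1) • Du u (0 - c * s, (0 : E d))) 0 := by
  refine hasFDerivAt_integral_of_dominated_of_fderiv_le
    (F := fun x s => u (0 - c * s, x) * η (s - 1))
    (F' := fun x s => η (s - 1) • Du u (0 - c * s, x))
    (bound := fun s => η (s - 1) * (S + D * c ^ ((σ - 1) / σ) + ‖Du u (-c, (0 : E d))‖))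
    (ball_mem_nhds _ one_pos)
    (.of_forall fun x => ((hu.isZygmund x).integrable_pastAvg hη hc le_rfl).aestronglyMeasurable)
    ((hu.isZygmund 0).integrable_pastAvg hη hc le_rfl)
    (hu.integrable_smul_du hη hσ hd hc).aestronglyMeasurable
    (.of_forall fun s x hx => ?_) (hη.integrable_shift.mul_const _) (.of_forall fun s x hx => ?_)
  · by_cases hs : s ∈ Ioo (0 : ℝ) 2
    · rw [norm_smul, Real.norm_of_nonneg (hη.nonneg _)]
      exact mul_le_mul_of_nonneg_left
        (hu.norm_du_le hσ hd hc hs (mem_ball_zero_iff.1 hx).le) (hη.nonneg _)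
    · simp [hη.shift_eq_zero hs]
  · by_cases hs : s ∈ Ioo (0 : ℝ) 2
    · exact (hu.differentiableAt_slice (by nlinarith [hs.1]) x).hasFDerivAt.mul_const _
    · simpa [hη.shift_eq_zero hs] using hasFDerivAt_const (0 : ℝ) x

lemma norm_integral_smul_du_sub_le (hη : IsEvenMollifier η) (hσ : 1 < σ) (hd : 1 ≤ d)
    (hu : IsParabolicHolder σ S Z D u) {c r t : ℝ} (hc : 0 < c) (hcr : c ≤ 2 * r)
    (ht : t ∈ Ioo (-r) 0) :
    ‖(∫ s, η (s - 1) • Du u (0 - c * s, (0 : E d))) - Du u (t, 0)‖ ≤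
      4 * (D * r ^ ((σ - 1) / σ)) := by
  have hr : 0 < r := by linarith
  have hγ : 0 < (σ - 1) / σ := div_pos (by linarith) (by linarith)
  have hγ1 : (σ - 1) / σ ≤ 1 := (div_le_one (by linarith)).2 (by linarith)
  have e : (∫ s, η (s - 1) • Du u (0 - c * s, (0 : E d))) - Du u (t, 0) =
      ∫ s, η (s - 1) • (Du u (0 - c * s, (0 : E d)) - Du u (t, 0)) := by
    simp only [smul_sub]
    rw [integral_sub (hu.integrable_smul_du hη hσ hd hc) (hη.integrable_shift.smul_const _),
      integral_smul_const, hη.integral_shift, one_smul]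
  rw [e]
  refine hη.norm_integral_smul_le fun s hs => ?_
  have hcs : 0 < c * s := mul_pos hc hs.1
  have hcs' : c * s ≤ 4 * r := by nlinarith [hs.2]
  refine (hu.du_time _ _ (by linarith) ht.2 0).trans ?_
  calc D * |0 - c * s - t| ^ ((σ - 1) / σ) ≤ D * (4 * r) ^ ((σ - 1) / σ) := by
        refine mul_le_mul_of_nonneg_left (Real.rpow_le_rpow (abs_nonneg _) ?_ hγ.le)
          hu.time_nonneg
        rw [abs_le]
        constructor <;> linarith [ht.1, ht.2]
    _ = 4 ^ ((σ - 1) / σ) * (D * r ^ ((σ - 1) / σ)) := by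
        rw [Real.mul_rpow (by norm_num) hr.le]; ring
    _ ≤ 4 * (D * r ^ ((σ - 1) / σ)) := by
        refine mul_le_mul_of_nonneg_right ?_ (mul_nonneg hu.time_nonneg (by positivity))
        exact Real.rpow_le_self_of_one_le (by norm_num) hγ1

lemma norm_fderiv_tmoll_sub_le (hη : IsEvenMollifier η) (hσ : 1 < σ) (hd : 1 ≤ d)
    (hu : IsParabolicHolder σ S Z D u) (hR : 0 < R) {t : ℝ} (ht : t ∈ Ioo (-(R ^ σ)) 0) :
    ‖fderiv ℝ (fun x => tmoll σ R η u (0, x)) 0 - Du u (t, 0)‖ ≤ 12 * (D * R ^ (σ - 1)) := by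
  have hr : 0 < R ^ σ := Real.rpow_pos_of_pos hR σ
  have e : R ^ (σ - 1) = (R ^ σ) ^ ((σ - 1) / σ) := by
    rw [← Real.rpow_mul hR.le, mul_div_cancel₀ _ (by linarith)]
  have h₁ := hu.norm_integral_smul_du_sub_le hη hσ hd hr (by linarith) ht
  have h₂ := hu.norm_integral_smul_du_sub_le hη hσ hd (c := 2 * R ^ σ) (by positivity) le_rfl ht
  have hL := ((hu.hasFDerivAt_pastAvg hη hσ hd hr).const_mul 2).fun_sub
    (hu.hasFDerivAt_pastAvg hη hσ hd (c := 2 * R ^ σ) (by positivity))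
  have hF : (fun x => tmoll σ R η u (0, x)) = fun x =>
      2 * pastAvg η (R ^ σ) (fun t => u (t, x)) 0 -
        pastAvg η (2 * R ^ σ) (fun t => u (t, x)) 0 :=
    funext fun x => tmoll_eq hη hu hR le_rfl x
  rw [hF, HasFDerivAt.fderiv hL, e]
  set L₁ := ∫ s, η (s - 1) • Du u (0 - R ^ σ * s, (0 : E d))
  set L₂ := ∫ s, η (s - 1) • Du u (0 - 2 * R ^ σ * s, (0 : E d))
  have h3 : (2 : ℝ) • L₁ - L₂ - Du u (t, 0) =
      (2 : ℝ) • (L₁ - Du u (t, 0)) - (L₂ - Du u (t, 0)) := by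
    rw [smul_sub, two_smul ℝ (Du u (t, 0))]
    abel
  rw [h3]
  refine (norm_sub_le _ _).trans ?_
  rw [norm_smul, Real.norm_two]
  linarith

/-- Spatial Hölder estimate for `u` minus the Taylor polynomial of its mollification. -/
lemma abs_space_diff_le (hη : IsEvenMollifier η) (hσ : 1 < σ) (hd : 1 ≤ d)
    (hu : IsParabolicHolder σ S Z D u) (hR : 0 < R) {t ρ : ℝ} (ht : t ∈ Ioo (-(R ^ σ)) 0)
    {x y : E d} (hx : x ∈ ball 0 ρ) (hy : y ∈ ball 0 ρ) :
    |(u (t, x) - tmollTaylor σ R η u (t, x)) - (u (t, y) - tmollTaylor σ R η u (t, y))| ≤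
      (S * ρ ^ (σ - 1) + 12 * (D * R ^ (σ - 1))) * ‖x - y‖ := by
  have h := (convex_ball (0 : E d) ρ).norm_image_sub_le_of_norm_fderiv_le' (𝕜 := ℝ)
    (f := fun x => u (t, x)) (φ := fderiv ℝ (fun x => tmoll σ R η u (0, x)) 0)
    (C := S * ρ ^ (σ - 1) + 12 * (D * R ^ (σ - 1)))
    (fun z _ => hu.differentiableAt_slice ht.2 z) (fun z hz => ?_) hy hx
  · rw [Real.norm_eq_abs, map_sub] at h
    convert h using 2
    simp only [tmollTaylor]
    ring
  · have h1 := hu.du_space t ht.2 z 0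
    have h2 := hu.norm_fderiv_tmoll_sub_le hη hσ hd hR ht
    rw [norm_sub_rev] at h2
    rw [sub_zero] at h1
    rw [mem_ball_zero_iff] at hz
    have h3 : S * ‖z‖ ^ (σ - 1) ≤ S * ρ ^ (σ - 1) :=
      mul_le_mul_of_nonneg_left (Real.rpow_le_rpow (norm_nonneg _) hz.le (by linarith))
        (hu.space_nonneg hd)
    change ‖Du u (t, z) - _‖ ≤ _
    rw [← sub_add_sub_cancel _ (Du u (t, 0))]
    exact (norm_add_le _ _).trans (by linarith)


lemma abs_taylor_coeff_sub_le (hη : IsEvenMollifier η) (hu : IsParabolicHolder σ S Z D u)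
    (hR : 0 < R) {A T q q₀ : ℝ} (hT : 0 < T) {x : E d}
    (hq : ∀ t ≤ 0, |tmoll σ R η u (t, x) - tmoll σ R η u (0, x) - t * q| ≤ A * t ^ 2)
    (hq₀ : ∀ t ≤ 0, |tmoll σ R η u (t, 0) - tmoll σ R η u (0, 0) - t * q₀| ≤ A * t ^ 2) :
    |q - q₀| ≤ 3 * (D * T ^ ((σ - 1) / σ - 1) * ‖x‖) + 2 * A * T := by
  have h := hu.abs_tmoll_mixed_le hη hR hT x
  have h₁ := hq (-T) (by linarith)
  have h₂ := hq₀ (-T) (by linarith)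
  have key : T * |q - q₀| ≤ T * (3 * (D * T ^ ((σ - 1) / σ - 1) * ‖x‖) + 2 * A * T) := by
    have e : T * (3 * (D * T ^ ((σ - 1) / σ - 1) * ‖x‖) + 2 * A * T) =
        3 * (D * T ^ ((σ - 1) / σ) * ‖x‖) + 2 * (A * (-T) ^ 2) := by
      rw [Real.rpow_sub_one hT.ne']
      field_simp
    rw [e, ← abs_of_pos hT, ← abs_mul, abs_of_pos hT]
    rw [abs_le] at *
    constructor <;> linarith
  exact le_of_mul_le_mul_left key hT

/-- Temporal Hölder estimate for `u` minus its own first-order expansion in time. -/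
lemma abs_time_diff_le (hη : IsEvenMollifier η) (hu : IsParabolicHolder σ S Z D u) (hR : 0 < R)
    {β q t s : ℝ} (hβ : β ∈ Ioo (0 : ℝ) 1) {x : E d}
    (hq : ∀ t ≤ 0, |tmoll σ R η u (t, x) - tmoll σ R η u (0, x) - t * q| ≤
      3 * (∫ s, |deriv (deriv η) s|) * Z * t ^ 2 / R ^ σ)
    (ht : t ∈ Ioo (-(R ^ σ)) 0) (hs : s ∈ Ioo (-(R ^ σ)) 0) :
    |u (t, x) - u (s, x) - (t - s) * q| ≤
      (2 * (2 + 48 * ∫ s, |deriv (deriv η) s|) + 1 / (1 - 2 ^ (β - 1))) * Z * R ^ σ *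
        (|t - s| / R ^ σ) ^ β := by
  have hr : 0 < R ^ σ := Real.rpow_pos_of_pos hR σ
  have hZ := (hu.isZygmund x).nonneg
  set K := ∫ s, |deriv (deriv η) s|
  have hK : 0 ≤ K := integral_nonneg fun _ => abs_nonneg _
  have hg : IsZygmund Z fun t => u (t, x) - (tmoll σ R η u (0, x) + t * q) := by
    refine ⟨(hu.isZygmund x).continuousOn.sub (by fun_prop), fun t h hh hth => ?_⟩
    convert hu.zygmund t x h hh hth using 2
    ring
  have hM : ∀ t ∈ Ioo (-(4 * R ^ σ)) 0,
      |u (t, x) - (tmoll σ R η u (0, x) + t * q)| ≤ (2 + 48 * K) * Z * R ^ σ := by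
    intro t ht
    have h₁ := hu.abs_sub_tmoll_le hη hR ht.2 x
    have h₂ := hq t ht.2.le
    have h₃ : 3 * K * Z * t ^ 2 / R ^ σ ≤ 48 * K * Z * R ^ σ := by
      rw [div_le_iff₀ hr]
      have : t ^ 2 ≤ 16 * (R ^ σ) ^ 2 := by nlinarith [ht.1, ht.2]
      calc 3 * K * Z * t ^ 2 ≤ 3 * K * Z * (16 * (R ^ σ) ^ 2) :=
            mul_le_mul_of_nonneg_left this (by positivity)
        _ = _ := by ring
    rw [abs_le] at *
    constructor <;> linarith
  have h := hg.abs_sub_le hr hβ hM ht hs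
  convert h using 1
  · congr 1
    ring
  · ring

lemma abs_tmollTaylor_time_diff_le (hη : IsEvenMollifier η) (hσ : 1 < σ) {α : ℝ}
    (hα : α ∈ Ioo (0 : ℝ) 1) (hu : IsParabolicHolder σ S Z D u) (hR : 0 < R) {t s : ℝ} (j : ℕ)
    (ht : t ∈ Ioo (-(R ^ σ)) 0) (hs : s ∈ Ioo (-(R ^ σ)) 0) {x : E d}
    (hx : x ∈ ball 0 ((2 : ℝ) ^ j * R)) :
    |(u (t, x) - tmollTaylor σ R η u (t, x)) - (u (s, x) - tmollTaylor σ R η u (s, x))| ≤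
      ((2 * (2 + 48 * ∫ s, |deriv (deriv η) s|) + 1 / (1 - 2 ^ (α / σ - 1))) * Z +
        3 * D * 2 ^ ((j : ℝ) * (σ + 1 - α) / 2) +
        6 * (∫ s, |deriv (deriv η) s|) * Z * 2 ^ ((j : ℝ) * (σ - α / 2))) *
        (R ^ (σ - α) * |t - s| ^ (α / σ)) := by
  have hr : 0 < R ^ σ := Real.rpow_pos_of_pos hR σ
  have hσ0 : 0 < σ := by linarith
  have hD := hu.time_nonneg
  have hβ : α / σ ∈ Ioo (0 : ℝ) 1 :=
    ⟨div_pos hα.1 hσ0, (div_lt_one hσ0).2 (by linarith [hα.2])⟩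
  obtain ⟨q, hq⟩ := hu.exists_tmoll_taylor hη hR x
  obtain ⟨q₀, hq₀⟩ := hu.exists_tmoll_taylor hη hR (0 : E d)
  have h₁ := hu.abs_time_diff_le hη hR hβ hq ht hs
  set K := ∫ s, |deriv (deriv η) s|
  set W := R ^ (σ - α) * |t - s| ^ (α / σ) with hW
  have hW' : R ^ σ * (|t - s| / R ^ σ) ^ (α / σ) = W := by
    rw [hW, Real.div_rpow (abs_nonneg _) hr.le, ← Real.rpow_mul hR.le,
      mul_div_cancel₀ _ hσ0.ne', Real.rpow_sub hR]
    ring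
  rw [mul_assoc _ (R ^ σ), hW'] at h₁
  have hA : ∀ t : ℝ, 3 * K * Z * t ^ 2 / R ^ σ = 3 * K * Z / R ^ σ * t ^ 2 := fun t => by ring
  simp only [hA] at hq hq₀
  have hder : derivWithin (fun s => tmoll σ R η u (s, (0 : E d))) (Iio 0) 0 = q₀ :=
    derivWithin_Iio_eq_of_quadratic hq₀
  have hT : 0 < R ^ σ * 2 ^ ((j : ℝ) * (σ - α / 2)) := by positivity
  have h₂ := hu.abs_taylor_coeff_sub_le hη hR hT hq hq₀
  have h₃ : |q - q₀| ≤ 3 * D * 2 ^ ((j : ℝ) * (σ + 1 - α) / 2) +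
      6 * K * Z * 2 ^ ((j : ℝ) * (σ - α / 2)) := by
    refine h₂.trans (add_le_add ?_ (le_of_eq (by field_simp; ring)))
    have : (R ^ σ * 2 ^ ((j : ℝ) * (σ - α / 2))) ^ ((σ - 1) / σ - 1) * ‖x‖ ≤
        2 ^ ((j : ℝ) * (σ + 1 - α) / 2) := by
      have hγ : (σ - 1) / σ - 1 = -(1 / σ) := by field_simp; ring
      have e : (R ^ σ * 2 ^ ((j : ℝ) * (σ - α / 2))) ^ ((σ - 1) / σ - 1) *
          ((2 : ℝ) ^ j * R) = 2 ^ ((j : ℝ) * (α / (2 * σ))) := by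
        rw [hγ, Real.mul_rpow hr.le (by positivity), ← Real.rpow_mul hR.le,
          ← Real.rpow_mul two_pos.le, mul_neg, mul_one_div, div_self hσ0.ne',
          Real.rpow_neg_one, ← Real.rpow_natCast]
        calc _ = (2 : ℝ) ^ ((j : ℝ) * (σ - α / 2) * -(1 / σ)) * 2 ^ (j : ℝ) := by
              field_simp
          _ = _ := by
              rw [← Real.rpow_add two_pos]
              congr 1
              field_simp
              ring
      refine (mul_le_mul_of_nonneg_left (mem_ball_zero_iff.1 hx).le (by positivity)).trans ?_
      rw [e, mul_div_assoc]
      refine Real.rpow_le_rpow_of_exponent_le one_le_two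
        (mul_le_mul_of_nonneg_left ?_ (Nat.cast_nonneg j))
      have : α / (2 * σ) ≤ 1 / 2 := by
        rw [div_le_div_iff₀ (by positivity) two_pos]
        linarith [hα.2]
      linarith [hα.2]
    calc _ = 3 * D * ((R ^ σ * 2 ^ ((j : ℝ) * (σ - α / 2))) ^ ((σ - 1) / σ - 1) * ‖x‖) := by ring
      _ ≤ _ := mul_le_mul_of_nonneg_left this (by positivity)
  have h₄ : |t - s| ≤ W := by
    have h : |t - s| / R ^ σ ≤ 1 := by
      rw [div_le_one hr, abs_le]
      constructor <;> linarith [ht.1, ht.2, hs.1, hs.2]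
    calc |t - s| = R ^ σ * (|t - s| / R ^ σ) := by field_simp
      _ ≤ R ^ σ * (|t - s| / R ^ σ) ^ (α / σ) :=
        mul_le_mul_of_nonneg_left (Real.self_le_rpow_of_le_one (by positivity) h hβ.2.le) hr.le
      _ = W := hW'
  have e : (u (t, x) - tmollTaylor σ R η u (t, x)) - (u (s, x) - tmollTaylor σ R η u (s, x)) =
      (u (t, x) - u (s, x) - (t - s) * q) + (q - q₀) * (t - s) := by
    simp only [tmollTaylor, hder]
    ring
  rw [e]
  refine (abs_add_le _ _).trans ?_
  rw [abs_mul (q - q₀)]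
  have h₅ := mul_le_mul h₃ h₄ (abs_nonneg _) ((abs_nonneg _).trans h₃)
  linarith

lemma abs_tmollTaylor_space_diff_le (hη : IsEvenMollifier η) (hσ : 1 < σ) (hd : 1 ≤ d) {α : ℝ}
    (hα : α ∈ Ioo (0 : ℝ) 1) (hu : IsParabolicHolder σ S Z D u) (hR : 0 < R) {t : ℝ} (j : ℕ)
    (ht : t ∈ Ioo (-(R ^ σ)) 0) {x y : E d} (hx : x ∈ ball 0 ((2 : ℝ) ^ j * R))
    (hy : y ∈ ball 0 ((2 : ℝ) ^ j * R)) :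
    |(u (t, x) - tmollTaylor σ R η u (t, x)) - (u (t, y) - tmollTaylor σ R η u (t, y))| ≤
      (2 * ((2 : ℝ) ^ j * R) ^ (σ - α) * S +
        24 * (2 : ℝ) ^ ((1 - α) * (j : ℝ)) * R ^ (σ - α) * D) * ‖x - y‖ ^ α := by
  have h := hu.abs_space_diff_le hη hσ hd hR ht hx hy
  have hS := hu.space_nonneg hd
  have hD := hu.time_nonneg
  set ρ := (2 : ℝ) ^ j * R with hρ
  have hρ0 : 0 < ρ := by positivity
  have hxy : ‖x - y‖ ≤ 2 * ρ := by
    rw [mem_ball_zero_iff] at hx hy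
    exact (norm_sub_le _ _).trans (by linarith)
  have h₁ : ‖x - y‖ ≤ 2 * ρ ^ (1 - α) * ‖x - y‖ ^ α := by
    rcases (norm_nonneg (x - y)).eq_or_lt with h0 | h0
    · rw [← h0]
      positivity
    calc ‖x - y‖ = ‖x - y‖ ^ (1 - α) * ‖x - y‖ ^ α := by
          rw [← Real.rpow_add h0, sub_add_cancel, Real.rpow_one]
      _ ≤ (2 * ρ) ^ (1 - α) * ‖x - y‖ ^ α :=
        mul_le_mul_of_nonneg_right
          (Real.rpow_le_rpow h0.le hxy (by linarith [hα.2])) (by positivity)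
      _ ≤ _ := by
        rw [Real.mul_rpow two_pos.le hρ0.le]
        have : (2 : ℝ) ^ (1 - α) ≤ 2 := Real.rpow_le_self_of_one_le one_le_two (by linarith [hα.1])
        gcongr
  have e₁ : ρ ^ (σ - 1) * ρ ^ (1 - α) = ρ ^ (σ - α) := by
    rw [← Real.rpow_add hρ0]
    congr 1
    ring
  have e₂ : R ^ (σ - 1) * ρ ^ (1 - α) = 2 ^ ((1 - α) * (j : ℝ)) * R ^ (σ - α) := by
    rw [hρ, Real.mul_rpow (by positivity) hR.le, ← Real.rpow_natCast, ← Real.rpow_mul two_pos.le,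
      mul_comm (j : ℝ), mul_left_comm, ← Real.rpow_add hR]
    congr 2
    ring
  refine h.trans ((mul_le_mul_of_nonneg_left h₁ (by positivity)).trans (le_of_eq ?_))
  linear_combination (2 * S * ‖x - y‖ ^ α) * e₁ + (24 * D * ‖x - y‖ ^ α) * e₂

end IsParabolicHolder

end Nonlocal

/-- Lemma 5.3: Hölder estimates in `x` and in `t` for `u - p`, where `p`
is the first-order Taylor expansion at the origin of the time mollification `u^{(R)}`. -/
theorem statement17 (d : ℕ) (hd : 1 ≤ d) (σ : ℝ) (hσ : σ ∈ Ioo (1 : ℝ) 2)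
    (α : ℝ) (hα : α ∈ Ioo (0 : ℝ) 1)
    -- the mollifier η: smooth, even, nonnegative, unit integral, supported in (-1,1)
    (η : ℝ → ℝ) (hηs : ContDiff ℝ (⊤ : ℕ∞) η) (hηe : ∀ s : ℝ, η (-s) = η s)
    (hηnn : ∀ s : ℝ, 0 ≤ η s) (hηi : (∫ s : ℝ, η s) = 1)
    (hηsupp : ∀ s : ℝ, s ∉ Ioo (-1 : ℝ) 1 → η s = 0) :
    ∃ C : ℝ, 0 < C ∧
      ∀ R : ℝ, 0 < R →
      ∀ (u : ℝ × E d → ℝ) (S Z D : ℝ),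
        -- u is continuous and differentiable in x on ℝ₀^{d+1}
        ContinuousOn u (lowerHalf d) →
        (∀ z ∈ lowerHalf d, DifferentiableAt ℝ (fun x => u (z.1, x)) z.2) →
        -- [u]^*_σ = [Du]^*_{σ-1} ≤ S
        (∀ t : ℝ, t < 0 → ∀ x y : E d,
          ‖Du u (t, x) - Du u (t, y)‖ ≤ S * ‖x - y‖ ^ (σ - 1)) →
        -- [u]^t_{Λ¹} ≤ Z
        (∀ (t : ℝ) (x : E d) (h : ℝ), 0 < h → t + h < 0 →
          |u (t + h, x) + u (t - h, x) - 2 * u (t, x)| ≤ Z * h) →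
        -- [Du]^t_{(σ-1)/σ} ≤ D
        (∀ t s : ℝ, t < 0 → s < 0 → ∀ x : E d,
          ‖Du u (t, x) - Du u (s, x)‖ ≤ D * |t - s| ^ ((σ - 1) / σ)) →
        ∀ j : ℕ,
          -- spatial Hölder estimate (5.4)
          (∀ t ∈ Ioo (-(R ^ σ)) (0 : ℝ), ∀ x ∈ ball (0 : E d) ((2 : ℝ) ^ j * R),
            ∀ y ∈ ball (0 : E d) ((2 : ℝ) ^ j * R),
            |(u (t, x) - tmollTaylor σ R η u (t, x))
                - (u (t, y) - tmollTaylor σ R η u (t, y))| ≤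
              (C * ((2 : ℝ) ^ j * R) ^ (σ - α) * S
                  + C * (2 : ℝ) ^ ((1 - α) * (j : ℝ)) * R ^ (σ - α) * D
                  + C * (2 : ℝ) ^ (-(j : ℝ) * α) * R ^ (σ - α) * Z) * ‖x - y‖ ^ α) ∧
          -- temporal Hölder estimate (5.5)
          (∀ t ∈ Ioo (-(R ^ σ)) (0 : ℝ), ∀ s ∈ Ioo (-(R ^ σ)) (0 : ℝ),
            ∀ x ∈ ball (0 : E d) ((2 : ℝ) ^ j * R),
            |(u (t, x) - tmollTaylor σ R η u (t, x))
                - (u (s, x) - tmollTaylor σ R η u (s, x))| ≤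
              (C * (2 : ℝ) ^ ((j : ℝ) * (σ - α / 2)) * R ^ (σ - α) * S
                  + C * (2 : ℝ) ^ ((j : ℝ) * (σ + 1 - α) / 2) * R ^ (σ - α) * D
                  + C * (2 : ℝ) ^ ((j : ℝ) * (σ - α / 2)) * R ^ (σ - α) * Z)
                * |t - s| ^ (α / σ)) := by
  have hη : IsEvenMollifier η := ⟨hηs, hηe, hηnn, hηi, hηsupp⟩
  set K := ∫ s, |deriv (deriv η) s| with hK
  have hK0 : 0 ≤ K := integral_nonneg fun _ => abs_nonneg _
  set H := 2 * (2 + 48 * K) + 1 / (1 - (2 : ℝ) ^ (α / σ - 1)) with hH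
  have hH0 : 0 ≤ H := by
    have h1 : α / σ < 1 := (div_lt_one (by linarith [hσ.1])).2 (by linarith [hσ.1, hα.2])
    have h2 : (2 : ℝ) ^ (α / σ - 1) < 1 :=
      Real.rpow_lt_one_of_one_lt_of_neg one_lt_two (by linarith)
    have h3 : 0 ≤ 1 / (1 - (2 : ℝ) ^ (α / σ - 1)) := one_div_nonneg.2 (by linarith)
    positivity
  refine ⟨24 + 6 * K + H, by positivity, fun R hR u S Z D hc hdiff hS hZ hD j => ?_⟩
  have hu : IsParabolicHolder σ S Z D u := ⟨hc, hdiff, hS, hZ, hD⟩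
  have hS0 := hu.space_nonneg hd
  have hD0 := hu.time_nonneg
  have hZ0 := (hu.isZygmund 0).nonneg
  refine ⟨fun t ht x hx y hy => ?_, fun t ht s hs x hx => ?_⟩
  · refine (hu.abs_tmollTaylor_space_diff_le hη hσ.1 hd hα hR j ht hx hy).trans
      (mul_le_mul_of_nonneg_right ?_ (by positivity))
    refine le_add_of_le_of_nonneg (add_le_add ?_ ?_) (by positivity) <;> gcongr <;> linarith
  · refine (hu.abs_tmollTaylor_time_diff_le hη hσ.1 hα hR j ht hs hx).trans ?_
    rw [← mul_assoc]
    refine mul_le_mul_of_nonneg_right ?_ (by positivity)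
    rw [← hK, ← hH]
    set P := (2 : ℝ) ^ ((j : ℝ) * (σ - α / 2)) with hP
    set Q := (2 : ℝ) ^ ((j : ℝ) * (σ + 1 - α) / 2)
    have hQ : 0 ≤ D * Q := by positivity
    have hP1 : 1 ≤ P := Real.one_le_rpow one_le_two
      (mul_nonneg (Nat.cast_nonneg j) (by linarith [hσ.1, hα.2]))
    have h1 : H * Z ≤ H * Z * P := le_mul_of_one_le_right (by positivity) hP1
    have h2 : 0 ≤ Z * P := by positivity
    have h3 : 0 ≤ (24 + 6 * K + H) * P * S := by positivity
    have h4 : 0 ≤ (6 * K + H) * (D * Q) := by positivity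
    calc _ ≤ ((24 + 6 * K + H) * P * S + (24 + 6 * K + H) * Q * D + (24 + 6 * K + H) * P * Z) *
          R ^ (σ - α) := mul_le_mul_of_nonneg_right (by linarith) (by positivity)
      _ = _ := by ring
end
end

section
/- Let σ = 1, α ∈ (0,1), and R > 0. Let u be defined on ℝ₀^{d+1} with finite space-time Zygmund seminorm [u]_{Λ¹} = [u]_{Λ¹(ℝ₀^{d+1})}. Let η be a smooth even nonnegative function on ℝ with unit integral vanishing outside (−1,1), let ζ ∈ C₀^∞(B₁) be a radial nonnegative function with unit integral, define u^{(R)}(t,x) = ∫_{ℝ^{d+1}} (2u(t − Rs, x − Ry) − u(t − 2Rs, x − Ry)) η(s−1) ζ(y) dy ds, and let p(t,x) = u^{(R)}(0,0) + t·∂_t u^{(R)}(0,0) + x·D_x u^{(R)}(0,0) be the first-order Taylor expansion of u^{(R)} at the origin. Then for every integer j ≥ 0: [u − p]_{α, α; (−R,0)×B_{2^j R}} ≤ C 2^{j(1−α/2)} R^{1−α} [u]_{Λ¹}, where C > 0 depends only on d, α, η, and ζ. -/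
open MeasureTheory Set Metric ENNReal
open scoped Classical
noncomputable section

open MeasureTheory Set Metric ENNReal Nonlocal

namespace Nonlocal

/-- The Zygmund seminorm of `u` on the lower half space is at most `Z`. -/
def ZygmundBound {d : ℕ} (u : ℝ × E d → ℝ) (Z : ℝ) : Prop :=
  ∀ z h : ℝ × E d, h ≠ 0 → z ∈ lowerHalf d → z + h ∈ lowerHalf d →
    z - h ∈ lowerHalf d → |u (z + h) + u (z - h) - 2 * u z| ≤ Z * ‖h‖

variable {d : ℕ}

lemma mem_lowerHalf {z : ℝ × E d} : z ∈ lowerHalf d ↔ z.1 < 0 := by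
  simp [lowerHalf]

namespace ZygmundBound

variable {u : ℝ × E d → ℝ} {Z : ℝ}

lemma nonneg (hu : ZygmundBound u Z) : 0 ≤ Z := by
  have h := hu (-2, 0) (1, 0) (by simp) (by rw [mem_lowerHalf]; norm_num)
    (by rw [mem_lowerHalf]; norm_num) (by rw [mem_lowerHalf]; norm_num)
  have h1 : ‖((1 : ℝ), (0 : E d))‖ = 1 := by simp [Prod.norm_def]
  rw [h1, mul_one] at h
  exact (abs_nonneg _).trans h

/-- The second difference estimate in terms of the two end points. -/
lemma midpoint (hu : ZygmundBound u Z) {z w : ℝ × E d} (hz : z.1 < 0) (hw : w.1 < 0) :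
    |u z + u w - 2 * u ((1 / 2 : ℝ) • (z + w))| ≤ Z / 2 * ‖z - w‖ := by
  by_cases hzw : z = w
  · subst hzw
    have : (1 / 2 : ℝ) • (z + z) = z := by rw [← two_smul ℝ z, smul_smul]; norm_num
    rw [this, sub_self, norm_zero, mul_zero]
    have : u z + u z - 2 * u z = 0 := by ring
    rw [this, abs_zero]
  · have e1 : (1 / 2 : ℝ) • (z + w) + (1 / 2 : ℝ) • (z - w) = z := by module
    have e2 : (1 / 2 : ℝ) • (z + w) - (1 / 2 : ℝ) • (z - w) = w := by module
    have h := hu ((1 / 2 : ℝ) • (z + w)) ((1 / 2 : ℝ) • (z - w))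
      (smul_ne_zero (by norm_num) (sub_ne_zero.2 hzw))
      (by rw [mem_lowerHalf]; simp; linarith)
      (by rw [e1]; exact mem_lowerHalf.2 hz) (by rw [e2]; exact mem_lowerHalf.2 hw)
    rw [e1, e2, norm_smul] at h
    refine h.trans (le_of_eq ?_)
    norm_num
    ring

lemma parallelogram (hu : ZygmundBound u Z) {z w z' w' : ℝ × E d} (hz : z.1 < 0) (hw : w.1 < 0)
    (hz' : z'.1 < 0) (hw' : w'.1 < 0) (h : z + w = z' + w') :
    |u z + u w - u z' - u w'| ≤ Z / 2 * (‖z - w‖ + ‖z' - w'‖) := by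
  have h1 := hu.midpoint hz hw
  have h2 := hu.midpoint hz' hw'
  rw [← h] at h2
  rw [abs_le] at *
  constructor <;> linarith

/-- Subtracting an affine function does not change the Zygmund bound. -/
lemma sub_affine (hu : ZygmundBound u Z) (a b : ℝ) (L : E d →L[ℝ] ℝ) :
    ZygmundBound (fun z => u z - (a + z.1 * b + L z.2)) Z := by
  intro z h hh h1 h2 h3
  refine le_of_eq_of_le (congrArg _ ?_) (hu z h hh h1 h2 h3)
  simp only [Prod.fst_add, Prod.snd_add, Prod.fst_sub, Prod.snd_sub, map_add, map_sub]
  ring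

end ZygmundBound

/-- A continuous function with bounded midpoint defect on an interval is close to the affine
function with the same boundary values. -/
lemma exists_affine_approx_Icc {g : ℝ → ℝ} {a b B : ℝ} (hab : a < b)
    (hg : ContinuousOn g (Icc a b))
    (h : ∀ x ∈ Icc a b, ∀ y ∈ Icc a b, |g x + g y - 2 * g ((x + y) / 2)| ≤ B) :
    ∃ m c : ℝ, ∀ x ∈ Icc a b, |g x - (m + c * x)| ≤ B := by
  set c := (g b - g a) / (b - a) with hc
  set k : ℝ → ℝ := fun x => g x - (g a - c * a + c * x) with hk
  have hba : b - a ≠ 0 := by linarith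
  have ka : k a = 0 := by simp only [hk]; ring
  have kb : k b = 0 := by
    have : c * (b - a) = g b - g a := by rw [hc]; field_simp
    simp only [hk]; linarith
  have kmid : ∀ x ∈ Icc a b, ∀ y ∈ Icc a b, |k x + k y - 2 * k ((x + y) / 2)| ≤ B := by
    intro x hx y hy
    refine le_of_eq_of_le (congrArg _ ?_) (h x hx y hy)
    simp only [hk]; ring
  have kcont : ContinuousOn (fun x => |k x|) (Icc a b) := by
    simp only [hk]
    fun_prop
  obtain ⟨x₀, hx₀, hmax⟩ := isCompact_Icc.exists_isMaxOn (nonempty_Icc.2 hab.le) kcont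
  have hmax' : ∀ x ∈ Icc a b, |k x| ≤ |k x₀| := fun x hx => hmax hx
  refine ⟨g a - c * a, c, fun x hx => (hmax' x hx).trans ?_⟩
  obtain ⟨h0, h1⟩ := hx₀
  rcases le_total x₀ ((a + b) / 2) with hle | hle
  · have hm : 2 * x₀ - a ∈ Icc a b := ⟨by linarith, by linarith⟩
    have h2 := kmid a ⟨le_rfl, hab.le⟩ _ hm
    have h3 := hmax' _ hm
    rw [show (a + (2 * x₀ - a)) / 2 = x₀ by ring, ka] at h2
    rcases abs_cases (k x₀) with h4 | h4 <;> rw [abs_le] at h2 h3 <;> linarith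
  · have hm : 2 * x₀ - b ∈ Icc a b := ⟨by linarith, by linarith⟩
    have h2 := kmid b ⟨hab.le, le_rfl⟩ _ hm
    have h3 := hmax' _ hm
    rw [show (b + (2 * x₀ - b)) / 2 = x₀ by ring, kb] at h2
    rcases abs_cases (k x₀) with h4 | h4 <;> rw [abs_le] at h2 h3 <;> linarith

namespace ZygmundBound

variable {u : ℝ × E d → ℝ} {Z : ℝ}

/-- On a horizontal line, a function with bounded Zygmund seminorm is nearly affine. -/
lemma exists_affine_approx_line (hu : ZygmundBound u Z) (hc : ContinuousOn u (lowerHalf d))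
    (i : Fin d) :
    ∃ m c : ℝ, ∀ x ∈ Icc (-2 : ℝ) 2,
      |u (-1, EuclideanSpace.single i x) - (m + c * x)| ≤ 2 * Z := by
  refine exists_affine_approx_Icc (g := fun x => u (-1, EuclideanSpace.single i x))
    (by norm_num) ?_ ?_
  · refine hc.comp (Continuous.continuousOn ?_) fun x _ => mem_lowerHalf.2 (by norm_num)
    have : (fun x : ℝ => ((-1 : ℝ), (EuclideanSpace.single i x : E d)))
        = fun x : ℝ => ((-1 : ℝ), x • (EuclideanSpace.single i (1 : ℝ) : E d)) := by
      ext x j <;> simp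
    rw [this]
    fun_prop
  · intro x hx y hy
    have h := hu.midpoint (z := (-1, EuclideanSpace.single i x))
      (w := (-1, EuclideanSpace.single i y)) (by norm_num) (by norm_num)
    have e : (1 / 2 : ℝ) • (((-1 : ℝ), EuclideanSpace.single i x) +
        ((-1 : ℝ), EuclideanSpace.single i y)) =
        ((-1 : ℝ), (EuclideanSpace.single i ((x + y) / 2) : E d)) := by
      ext j
      · norm_num
      · simp only [Prod.smul_snd, Prod.snd_add, PiLp.smul_apply, PiLp.add_apply,
          PiLp.single_apply, smul_eq_mul]
        split_ifs <;> ring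
    rw [e] at h
    refine h.trans ?_
    have hn : ‖(((-1 : ℝ), EuclideanSpace.single i x) : ℝ × E d) -
        ((-1 : ℝ), EuclideanSpace.single i y)‖ ≤ 4 := by
      have : (EuclideanSpace.single i x : E d) - EuclideanSpace.single i y =
          EuclideanSpace.single i (x - y) := by
        ext j; simp only [PiLp.sub_apply, PiLp.single_apply]; split_ifs <;> ring
      rw [Prod.mk_sub_mk, this, Prod.norm_mk, PiLp.norm_single]
      obtain ⟨h1, h2⟩ := hx
      obtain ⟨h3, h4⟩ := hy
      simp only [sub_self, norm_zero, Real.norm_eq_abs]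
      exact max_le (by norm_num) (abs_le.2 ⟨by linarith, by linarith⟩)
    nlinarith [hu.nonneg]

lemma exists_affine_approx_time (hu : ZygmundBound u Z) (hc : ContinuousOn u (lowerHalf d)) :
    ∃ m c : ℝ, ∀ t ∈ Ico (-5 : ℝ) 0, |u (t, 0) - (m + c * t)| ≤ 7 * Z := by
  have hZ := hu.nonneg
  have hmid : ∀ x < 0, ∀ y < 0, |u (x, 0) + u (y, 0) - 2 * u ((x + y) / 2, 0)| ≤
      Z / 2 * |x - y| := by
    intro x hx y hy
    have h := hu.midpoint (z := (x, 0)) (w := (y, 0)) hx hy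
    have e : (1 / 2 : ℝ) • ((x, (0 : E d)) + (y, (0 : E d))) = ((x + y) / 2, (0 : E d)) := by
      ext j
      · simp; ring
      · simp
    rw [e] at h
    simpa [Prod.norm_def] using h
  obtain ⟨m, c, h⟩ := exists_affine_approx_Icc (g := fun t => u (t, (0 : E d))) (a := -5)
    (b := -1) (B := 2 * Z) (by norm_num)
    (hc.comp (Continuous.continuousOn (by fun_prop))
      fun x hx => mem_lowerHalf.2 (by have := hx.2; simp only; linarith)) (by
      intro x hx y hy
      refine (hmid x (by linarith [hx.2]) y (by linarith [hy.2])).trans ?_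
      have : |x - y| ≤ 4 := abs_le.2 ⟨by linarith [hx.1, hy.2], by linarith [hx.2, hy.1]⟩
      nlinarith)
  refine ⟨m, c, fun t ht => ?_⟩
  rcases le_or_gt t (-1) with h1 | h1
  · exact (h t ⟨ht.1, h1⟩).trans (by linarith)
  · have a1 := h (-1) ⟨by norm_num, le_rfl⟩
    have a2 := h (-2 - t) ⟨by linarith [ht.2], by linarith⟩
    have a3 := hmid t ht.2 (-2 - t) (by linarith)
    have a4 : |t - (-2 - t)| ≤ 2 := abs_le.2 ⟨by linarith, by linarith [ht.2]⟩
    have a5 : Z / 2 * |t - (-2 - t)| ≤ Z := by nlinarith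
    rw [show (t + (-2 - t)) / 2 = -1 by ring] at a3
    simp only [abs_le] at *
    constructor <;> linarith

/-- The increments of `u` on a horizontal slice are nearly additive over coordinates. -/
lemma sum_coord (hu : ZygmundBound u Z) {x : E d} (hx : ‖x‖ ≤ 2) (s : Finset (Fin d)) :
    ‖∑ i ∈ s, EuclideanSpace.single i (x i)‖ ≤ 2 * s.card ∧
    |u (-1, ∑ i ∈ s, EuclideanSpace.single i (x i)) - u (-1, 0) -
      ∑ i ∈ s, (u (-1, EuclideanSpace.single i (x i)) - u (-1, 0))| ≤
      Z * (2 * d + 2) * s.card := by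
  have hZ := hu.nonneg
  induction s using Finset.induction_on with
  | empty => simp
  | insert i s hi ih =>
    obtain ⟨ih1, ih2⟩ := ih
    have hs : (s.card : ℝ) ≤ d := by
      exact_mod_cast (Finset.card_le_univ s).trans (by simp)
    have hxi : ‖(EuclideanSpace.single i (x i) : E d)‖ ≤ 2 := by
      rw [PiLp.norm_single]
      exact (PiLp.norm_apply_le x i).trans hx
    rw [Finset.sum_insert hi, Finset.sum_insert hi, Finset.card_insert_of_notMem hi]
    set y := ∑ i ∈ s, (EuclideanSpace.single i (x i) : E d)
    set e := (EuclideanSpace.single i (x i) : E d)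
    push_cast
    refine ⟨(norm_add_le _ _).trans (by linarith), ?_⟩
    have h := hu.parallelogram (z := (-1, e + y)) (w := (-1, 0)) (z' := (-1, e)) (w' := (-1, y))
      (by norm_num) (by norm_num) (by norm_num) (by norm_num) (by simp)
    have n1 : ‖((-1 : ℝ), e + y) - (-1, 0)‖ ≤ 2 * d + 2 := by
      rw [Prod.mk_sub_mk, Prod.norm_mk]
      simp only [sub_self, norm_zero, sub_zero]
      exact max_le (by positivity) ((norm_add_le _ _).trans (by linarith))
    have n2 : ‖((-1 : ℝ), e) - (-1, y)‖ ≤ 2 * d + 2 := by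
      rw [Prod.mk_sub_mk, Prod.norm_mk]
      simp only [sub_self, norm_zero]
      exact max_le (by positivity) ((norm_sub_le _ _).trans (by linarith))
    have h' : Z / 2 * (‖((-1 : ℝ), e + y) - (-1, 0)‖ + ‖((-1 : ℝ), e) - (-1, y)‖) ≤
        Z * (2 * d + 2) := by nlinarith
    have h2 := h.trans h'
    rw [abs_le] at *
    constructor <;> linarith

/-- A function with bounded Zygmund seminorm is close to an affine function at unit scale. -/
lemma exists_affine_approx (hu : ZygmundBound u Z) (hc : ContinuousOn u (lowerHalf d)) :
    ∃ (a b : ℝ) (L : E d →L[ℝ] ℝ), ∀ z ∈ Ico (-5 : ℝ) 0 ×ˢ closedBall (0 : E d) 2,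
      |u z - (a + z.1 * b + L z.2)| ≤ (12 + (2 * d + 2) * d + 2 * d) * Z := by
  have hZ := hu.nonneg
  choose m c hmc using hu.exists_affine_approx_line hc
  obtain ⟨m₀, c₀, h₀⟩ := hu.exists_affine_approx_time hc
  refine ⟨m₀ + ∑ i, (m i - u (-1, 0)), c₀, ∑ i, c i • EuclideanSpace.proj i, ?_⟩
  rintro ⟨t, x⟩ ⟨ht, hx⟩
  simp only [mem_closedBall, dist_zero_right] at hx ht ⊢
  have hsum : ∑ i, (EuclideanSpace.single i (x i) : E d) = x := by
    ext j
    simp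
  have h1 := (hu.sum_coord hx Finset.univ).2
  rw [hsum, Finset.card_univ, Fintype.card_fin] at h1
  have h2 := h₀ t ht
  have h3 := hu.parallelogram (z := (t, x)) (w := (-1, 0)) (z' := (t, 0)) (w' := (-1, x))
    ht.2 (by norm_num) ht.2 (by norm_num) (by simp)
  have t4 : |t + 1| ≤ 4 := abs_le.2 ⟨by linarith [ht.1], by linarith [ht.2]⟩
  have n1 : ‖(t, x) - ((-1 : ℝ), (0 : E d))‖ ≤ 4 := by
    rw [Prod.mk_sub_mk, Prod.norm_mk]
    exact max_le (by simpa using t4) (by rw [sub_zero]; linarith)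
  have n2 : ‖(t, (0 : E d)) - ((-1 : ℝ), x)‖ ≤ 4 := by
    rw [Prod.mk_sub_mk, Prod.norm_mk]
    exact max_le (by simpa using t4) (by rw [zero_sub, norm_neg]; linarith)
  have h3' := h3.trans (show _ ≤ 4 * Z by nlinarith)
  have h4 : |∑ i, (u (-1, EuclideanSpace.single i (x i)) - (m i + c i * x i))| ≤ d * (2 * Z) := by
    refine (Finset.abs_sum_le_sum_abs _ _).trans ?_
    refine (Finset.sum_le_card_nsmul _ _ (2 * Z) fun i _ => hmc i (x i) ?_).trans ?_
    · exact abs_le.1 ((PiLp.norm_apply_le x i).trans hx)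
    · simp
  have h5 : (∑ i, c i • EuclideanSpace.proj i : E d →L[ℝ] ℝ) x = ∑ i, c i * x i := by
    simp
  rw [h5]
  simp only [Finset.sum_sub_distrib, Finset.sum_add_distrib] at h1 h4 ⊢
  rw [abs_le] at *
  constructor <;> linarith

end ZygmundBound

end Nonlocal
namespace Nonlocal

variable {d : ℕ}

instance : (volume : Measure (ℝ × E d)).IsAddHaarMeasure :=
  inferInstanceAs ((volume : Measure ℝ).prod (volume : Measure (E d))).IsAddHaarMeasure

/-- The space-time mollification kernel. -/
def stKernel (η : ℝ → ℝ) (ζ : E d → ℝ) (w : ℝ × E d) : ℝ := η (w.1 - 1) * ζ w.2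

lemma norm_convolution_le {G F F' : Type*} [NormedAddCommGroup G] [MeasurableSpace G]
    [BorelSpace G] [NormedAddCommGroup F] [NormedSpace ℝ F] [NormedAddCommGroup F']
    [NormedSpace ℝ F'] (μ : Measure G) [μ.IsAddLeftInvariant] [μ.IsNegInvariant]
    (L : ℝ →L[ℝ] F →L[ℝ] F') (hL : ∀ a b, ‖L a b‖ ≤ |a| * ‖b‖) {f : G → ℝ} {g : G → F} {M : ℝ}
    (hf : ∀ x, |f x| ≤ M) (hg : Integrable g μ) (x : G) :
    ‖convolution f g L μ x‖ ≤ M * ∫ y, ‖g y‖ ∂μ := by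
  have hM : 0 ≤ M := (abs_nonneg _).trans (hf x)
  rw [convolution_def]
  calc ‖∫ t, L (f t) (g (x - t)) ∂μ‖ ≤ ∫ t, M * ‖g (x - t)‖ ∂μ := by
        refine norm_integral_le_of_norm_le ((hg.norm.comp_sub_left x).const_mul M) ?_
        refine Filter.Eventually.of_forall fun t => (hL _ _).trans ?_
        exact mul_le_mul_of_nonneg_right (hf t) (norm_nonneg _)
    _ = M * ∫ y, ‖g y‖ ∂μ := by
        rw [integral_const_mul, integral_sub_left_eq_self (fun y => ‖g y‖) μ x]

/-- Convolving a bounded function with a smooth kernel of compact support gives a differentiable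
function, with bounds on the value and the derivative. -/
lemma exists_hasFDerivAt_convolution {G : Type*} [NormedAddCommGroup G] [NormedSpace ℝ G]
    [MeasurableSpace G] [BorelSpace G] [FiniteDimensional ℝ G] (μ : Measure G)
    [μ.IsAddHaarMeasure] {f K : G → ℝ} {M : ℝ} (hf : Measurable f) (hM : ∀ x, |f x| ≤ M)
    (hK : ContDiff ℝ 1 K) (hKc : HasCompactSupport K) (x : G) :
    ∃ V' : G →L[ℝ] ℝ, HasFDerivAt (convolution f K (ContinuousLinearMap.mul ℝ ℝ) μ) V' x ∧
      |convolution f K (ContinuousLinearMap.mul ℝ ℝ) μ x| ≤ M * ∫ y, ‖K y‖ ∂μ ∧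
      ‖V'‖ ≤ M * ∫ y, ‖fderiv ℝ K y‖ ∂μ := by
  have hfint : LocallyIntegrable f μ :=
    (locallyIntegrable_const M).mono hf.aestronglyMeasurable
      (Filter.Eventually.of_forall fun w => (hM w).trans (le_abs_self _))
  refine ⟨_, hKc.hasFDerivAt_convolution_right (ContinuousLinearMap.mul ℝ ℝ) hfint hK x, ?_, ?_⟩
  · exact norm_convolution_le μ (ContinuousLinearMap.mul ℝ ℝ) (fun a b => (norm_mul a b).le) hM
      (hK.continuous.integrable_of_hasCompactSupport hKc) x
  · have hL : ∀ (a : ℝ) (b : G →L[ℝ] ℝ),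
        ‖(ContinuousLinearMap.mul ℝ ℝ).precompR G a b‖ ≤ |a| * ‖b‖ := by
      intro a b
      refine ContinuousLinearMap.opNorm_le_bound _ (by positivity) fun y => ?_
      change ‖a * b y‖ ≤ _
      rw [norm_mul, mul_assoc]
      exact mul_le_mul_of_nonneg_left (b.le_opNorm y) (norm_nonneg _)
    have hK' : Integrable (fderiv ℝ K) μ :=
      (hK.continuous_fderiv one_ne_zero).integrable_of_hasCompactSupport (hKc.fderiv ℝ)
    exact norm_convolution_le μ ((ContinuousLinearMap.mul ℝ ℝ).precompR G) hL hM hK' x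

section Kernel

variable {η : ℝ → ℝ} {ζ : E d → ℝ}

lemma stKernel_ne_zero (hη : ∀ s : ℝ, s ∉ Ioo (-1 : ℝ) 1 → η s = 0)
    (hζ : ∀ y : E d, y ∉ ball (0 : E d) 1 → ζ y = 0) {w : ℝ × E d} (h : stKernel η ζ w ≠ 0) :
    0 < w.1 ∧ w.1 < 2 ∧ ‖w.2‖ < 1 := by
  have h1 : w.1 - 1 ∈ Ioo (-1 : ℝ) 1 := by
    by_contra h1
    exact h (by rw [stKernel, hη _ h1, zero_mul])
  have h2 : w.2 ∈ ball (0 : E d) 1 := by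
    by_contra h2
    exact h (by rw [stKernel, hζ _ h2, mul_zero])
  exact ⟨by linarith [h1.1], by linarith [h1.2], by simpa using h2⟩

lemma contDiff_stKernel (hη : ContDiff ℝ (⊤ : ℕ∞) η) (hζ : ContDiff ℝ (⊤ : ℕ∞) ζ) :
    ContDiff ℝ (⊤ : ℕ∞) (stKernel η ζ) := by
  unfold stKernel
  exact (hη.comp (contDiff_fst.sub contDiff_const)).mul (hζ.comp contDiff_snd)

lemma hasCompactSupport_stKernel (hη : ∀ s : ℝ, s ∉ Ioo (-1 : ℝ) 1 → η s = 0)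
    (hζ : ∀ y : E d, y ∉ ball (0 : E d) 1 → ζ y = 0) : HasCompactSupport (stKernel η ζ) := by
  refine HasCompactSupport.intro
    (isCompact_Icc.prod (isCompact_closedBall (0 : E d) 1) : IsCompact (Icc (0 : ℝ) 2 ×ˢ _)) ?_
  intro w hw
  by_contra h
  obtain ⟨h1, h2, h3⟩ := stKernel_ne_zero hη hζ h
  exact hw ⟨⟨h1.le, h2.le⟩, by simpa using h3.le⟩

lemma integral_stKernel (hη : ∫ s, η s = 1) (hζ : ∫ y, ζ y = 1) :
    ∫ w, stKernel η ζ w = 1 := by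
  have h : ∫ s, η (s - 1) = 1 := by rw [integral_sub_right_eq_self η 1, hη]
  have := integral_prod_mul (μ := (volume : Measure ℝ)) (ν := (volume : Measure (E d)))
    (fun s => η (s - 1)) ζ
  rw [h, hζ, one_mul] at this
  exact this

lemma integral_linear_mul_stKernel (hζ : ∀ y, ζ (-y) = ζ y) (L : E d →L[ℝ] ℝ) :
    ∫ w : ℝ × E d, L w.2 * stKernel η ζ w = 0 := by
  have h : ∫ y, L y * ζ y = 0 := by
    have h1 := integral_neg_eq_self (fun y => L y * ζ y) (volume : Measure (E d))
    simp only [map_neg, hζ, neg_mul, integral_neg] at h1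
    linarith
  have := integral_prod_mul (μ := (volume : Measure ℝ)) (ν := (volume : Measure (E d)))
    (fun s => η (s - 1)) (fun y => L y * ζ y)
  rw [h, mul_zero] at this
  rw [← this]
  refine integral_congr_ae (Filter.Eventually.of_forall fun w => ?_)
  simp only [stKernel]
  ring

lemma integrable_comp_mul_stKernel (hηs : ContDiff ℝ (⊤ : ℕ∞) η) (hζs : ContDiff ℝ (⊤ : ℕ∞) ζ)
    (hη : ∀ s : ℝ, s ∉ Ioo (-1 : ℝ) 1 → η s = 0)
    (hζ : ∀ y : E d, y ∉ ball (0 : E d) 1 → ζ y = 0) {v : ℝ × E d → ℝ} {M : ℝ}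
    (hv : Measurable v) (hM : ∀ z, |v z| ≤ M) {φ : ℝ × E d → ℝ × E d} (hφ : Measurable φ) :
    Integrable (fun w => v (φ w) * stKernel η ζ w) :=
  ((contDiff_stKernel hηs hζs).continuous.integrable_of_hasCompactSupport
    (hasCompactSupport_stKernel hη hζ)).bdd_mul (c := M)
    (hv.comp hφ).aestronglyMeasurable (Filter.Eventually.of_forall fun _ => hM _)

/-- The space-time mollification at unit scale is a convolution with a smooth kernel of compact
support. -/
lemma exists_stmoll_eq_convolution (hηs : ContDiff ℝ (⊤ : ℕ∞) η)
    (hζs : ContDiff ℝ (⊤ : ℕ∞) ζ)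
    (hη : ∀ s : ℝ, s ∉ Ioo (-1 : ℝ) 1 → η s = 0)
    (hζ : ∀ y : E d, y ∉ ball (0 : E d) 1 → ζ y = 0) :
    ∃ K : ℝ × E d → ℝ, ContDiff ℝ 1 K ∧ HasCompactSupport K ∧
      ∀ (v : ℝ × E d → ℝ) (M : ℝ), Measurable v → (∀ z, |v z| ≤ M) →
        stmoll 1 η ζ v = convolution v K (ContinuousLinearMap.mul ℝ ℝ) volume := by
  set k := stKernel η ζ with hk
  let A : (ℝ × E d) ≃L[ℝ] (ℝ × E d) :=
    (ContinuousLinearEquiv.smulLeft (Units.mk0 (2 : ℝ) two_ne_zero)).prodCongr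
      (ContinuousLinearEquiv.refl ℝ (E d))
  have hA : ∀ w : ℝ × E d, A w = (2 * w.1, w.2) := fun w => rfl
  obtain ⟨c, hc⟩ : ∃ c : ℝ, ∀ f : ℝ × E d → ℝ, ∫ w, f (A w) = c * ∫ w, f w := by
    have hdet : LinearMap.det (A.toLinearEquiv : (ℝ × E d) →ₗ[ℝ] (ℝ × E d)) ≠ 0 :=
      (LinearEquiv.isUnit_det' A.toLinearEquiv).ne_zero
    refine ⟨|(LinearMap.det (A.toLinearEquiv : (ℝ × E d) →ₗ[ℝ] (ℝ × E d)))⁻¹|, fun f => ?_⟩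
    have h := Measure.map_linearMap_addHaar_eq_smul_addHaar
      (volume : Measure (ℝ × E d)) hdet
    have h2 := A.toHomeomorph.measurableEmbedding.integral_map
      (μ := (volume : Measure (ℝ × E d))) f
    have h3 : Measure.map (A.toHomeomorph) (volume : Measure (ℝ × E d)) = _ := h
    rw [h3, integral_smul_measure, ENNReal.toReal_ofReal (abs_nonneg _)] at h2
    exact h2.symm
  have hks : ContDiff ℝ 1 k := (contDiff_stKernel hηs hζs).of_le (by exact_mod_cast le_top)
  have hkc := hasCompactSupport_stKernel hη hζ
  refine ⟨fun w => 2 * k w - c * k (A.symm w), ?_, ?_, ?_⟩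
  · exact (contDiff_const.mul hks).sub (contDiff_const.mul (hks.comp A.symm.contDiff))
  · exact hkc.mul_left.sub ((hkc.comp_homeomorph A.symm.toHomeomorph).mul_left)
  · intro v M hv hM
    funext z
    have i1 := integrable_comp_mul_stKernel hηs hζs hη hζ hv hM
      (φ := fun w => z - w) (by fun_prop)
    have i2 := integrable_comp_mul_stKernel hηs hζs hη hζ hv hM
      (φ := fun w => z - A w) (by fun_prop)
    have e1 : stmoll 1 η ζ v z = 2 * (∫ w, v (z - w) * k w) - ∫ w, v (z - A w) * k w := by
      rw [← integral_const_mul, ← integral_sub (i1.const_mul 2) i2]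
      refine integral_congr_ae (Filter.Eventually.of_forall fun w => ?_)
      simp only [hA, one_mul, mul_one, one_smul, stKernel, Prod.sub_def]
      ring
    have e2 : ∫ w, v (z - A w) * k w = c * ∫ w, v (z - w) * k (A.symm w) := by
      rw [← hc]
      simp
    have i3 : Integrable (fun w => v (z - w) * k (A.symm w)) := by
      have hAk : Integrable (fun w => k (A.symm w)) :=
        (hks.continuous.comp A.symm.continuous).integrable_of_hasCompactSupport
          (hkc.comp_homeomorph A.symm.toHomeomorph)
      exact hAk.bdd_mul (c := M) (hv.comp (by fun_prop)).aestronglyMeasurable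
        (Filter.Eventually.of_forall fun _ => hM _)
    rw [e1, e2, convolution_def, ← integral_const_mul, ← integral_const_mul,
      ← integral_sub (i1.const_mul 2) (i3.const_mul c),
      ← integral_sub_left_eq_self _ (volume : Measure (ℝ × E d)) z]
    refine integral_congr_ae (Filter.Eventually.of_forall fun w => ?_)
    have hzw : z - (z - w) = w := sub_sub_cancel z w
    simp only [ContinuousLinearMap.mul_apply', hzw]
    ring

end Kernel

end Nonlocal
namespace Nonlocal

variable {d : ℕ} {η : ℝ → ℝ} {ζ : E d → ℝ}

/-- The space-time mollification at unit scale reproduces affine functions near the origin. -/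
lemma stmoll_eq_affine_add (hηs : ContDiff ℝ (⊤ : ℕ∞) η) (hζs : ContDiff ℝ (⊤ : ℕ∞) ζ)
    (hη : ∀ s : ℝ, s ∉ Ioo (-1 : ℝ) 1 → η s = 0)
    (hζ : ∀ y : E d, y ∉ ball (0 : E d) 1 → ζ y = 0)
    (hηi : ∫ s, η s = 1) (hζi : ∫ y, ζ y = 1) (hζe : ∀ y, ζ (-y) = ζ y)
    {u v : ℝ × E d → ℝ} {M a b : ℝ} {L : E d →L[ℝ] ℝ}
    (hv : Measurable v) (hM : ∀ z, |v z| ≤ M)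
    (huv : ∀ z ∈ Ico (-5 : ℝ) 0 ×ˢ closedBall (0 : E d) 2, u z = a + z.1 * b + L z.2 + v z)
    {z : ℝ × E d} (hz : z.1 ∈ Icc (-1 : ℝ) 0) (hz' : ‖z.2‖ ≤ 1) :
    stmoll 1 η ζ u z = a + z.1 * b + L z.2 + stmoll 1 η ζ v z := by
  set k := stKernel η ζ with hk
  have kint : Integrable k := (contDiff_stKernel hηs hζs).continuous.integrable_of_hasCompactSupport
    (hasCompactSupport_stKernel hη hζ)
  have i1 := integrable_comp_mul_stKernel hηs hζs hη hζ hv hM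
    (φ := fun w => z - w) (by fun_prop)
  have i2 := integrable_comp_mul_stKernel hηs hζs hη hζ hv hM
    (φ := fun w => (z.1 - 2 * w.1, z.2 - w.2)) (by fun_prop)
  have i3 : Integrable (fun w : ℝ × E d => L w.2 * k w) :=
    ((L.continuous.comp continuous_snd).mul
      (contDiff_stKernel hηs hζs).continuous).integrable_of_hasCompactSupport
      (hasCompactSupport_stKernel hη hζ).mul_left
  have e : ∀ w : ℝ × E d,
      (2 * u (z.1 - 1 * w.1, z.2 - (1 : ℝ) • w.2) - u (z.1 - 2 * 1 * w.1, z.2 - (1 : ℝ) • w.2)) *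
        (η (w.1 - 1) * ζ w.2) =
      ((a + z.1 * b + L z.2) * k w - L w.2 * k w) +
        (2 * (v (z - w) * k w) - v (z.1 - 2 * w.1, z.2 - w.2) * k w) := by
    intro w
    rw [show η (w.1 - 1) * ζ w.2 = k w from rfl]
    by_cases h : k w = 0
    · simp [h]
    obtain ⟨h1, h2, h3⟩ := stKernel_ne_zero hη hζ h
    have hn : ‖z.2 - w.2‖ ≤ 2 := (norm_sub_le _ _).trans (by linarith)
    rw [huv (z.1 - 1 * w.1, z.2 - (1 : ℝ) • w.2)
        ⟨⟨by simp only; linarith [hz.1], by simp only; linarith [hz.2]⟩, by simpa using hn⟩,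
      huv (z.1 - 2 * 1 * w.1, z.2 - (1 : ℝ) • w.2)
        ⟨⟨by simp only; linarith [hz.1], by simp only; linarith [hz.2]⟩, by simpa using hn⟩]
    simp only [one_mul, mul_one, one_smul, Prod.sub_def, map_sub]
    ring
  have e' : stmoll 1 η ζ v z = ∫ w, (2 * (v (z - w) * k w) -
      v (z.1 - 2 * w.1, z.2 - w.2) * k w) := by
    refine integral_congr_ae (Filter.Eventually.of_forall fun w => ?_)
    simp only [one_mul, mul_one, one_smul, hk, stKernel, Prod.sub_def]
    ring
  have hu_eq : stmoll 1 η ζ u z = ∫ w, (((a + z.1 * b + L z.2) * k w - L w.2 * k w) +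
        (2 * (v (z - w) * k w) - v (z.1 - 2 * w.1, z.2 - w.2) * k w)) :=
    integral_congr_ae (Filter.Eventually.of_forall e)
  have hadd := integral_add ((kint.const_mul (a + z.1 * b + L z.2)).sub i3)
    ((i1.const_mul 2).sub i2)
  simp only [Pi.sub_apply, ← hk] at hadd
  rw [hu_eq, hadd, ← e',
    integral_sub (kint.const_mul _) i3, integral_const_mul, hk, integral_stKernel hηi hζi,
    integral_linear_mul_stKernel hζe]
  ring

/-- If the mollification agrees with a differentiable function for nonpositive times near the
origin, then so does the Taylor expansion at the origin. -/
lemma stmollTaylor_eq_of_hasFDerivAt {u W : ℝ × E d → ℝ} {W' : ℝ × E d →L[ℝ] ℝ}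
    (hW : HasFDerivAt W W' 0)
    (h : ∀ z : ℝ × E d, z.1 ∈ Icc (-1 : ℝ) 0 → ‖z.2‖ ≤ 1 → stmoll 1 η ζ u z = W z)
    (z : ℝ × E d) : stmollTaylor 1 η ζ u z = W 0 + W' z := by
  have h0 : ((0 : ℝ), (0 : E d)) = 0 := rfl
  have ht : derivWithin (fun s => stmoll 1 η ζ u (s, (0 : E d))) (Iio (0 : ℝ)) 0 = W' (1, 0) := by
    have h1 : HasDerivAt (fun s : ℝ => W (s, (0 : E d))) (W' (1, 0)) 0 :=
      HasFDerivAt.comp_hasDerivAt (x := (0 : ℝ)) (f := fun s : ℝ => (s, (0 : E d))) (l := W)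
        hW ((hasDerivAt_id _).prodMk (hasDerivAt_const _ _))
    refine (h1.hasDerivWithinAt.congr_of_eventuallyEq ?_ ?_).derivWithin (uniqueDiffWithinAt_Iio 0)
    · have : ∀ᶠ s in nhdsWithin (0 : ℝ) (Iio 0), s ∈ Ioi (-1 : ℝ) :=
        nhdsWithin_le_nhds (Ioi_mem_nhds (by norm_num))
      filter_upwards [this, self_mem_nhdsWithin] with s hs1 hs2
      exact h _ ⟨le_of_lt hs1, le_of_lt hs2⟩ (by simp)
    · exact h _ ⟨by norm_num, le_rfl⟩ (by simp)
  have hx : fderiv ℝ (fun x => stmoll 1 η ζ u ((0 : ℝ), x)) 0 =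
      W'.comp (ContinuousLinearMap.inr ℝ ℝ (E d)) := by
    have h1 : HasFDerivAt (fun x : E d => W ((0 : ℝ), x))
        (W'.comp (ContinuousLinearMap.inr ℝ ℝ (E d))) 0 :=
      HasFDerivAt.comp (x := (0 : E d)) (f := fun x : E d => ((0 : ℝ), x)) (g := W)
        hW (hasFDerivAt_prodMk_right (0 : ℝ) (0 : E d))
    refine (h1.congr_of_eventuallyEq ?_).fderiv
    filter_upwards [closedBall_mem_nhds (0 : E d) one_pos] with x hx
    exact h _ ⟨by norm_num, le_rfl⟩ (by simpa using hx)
  rw [stmollTaylor, ht, hx, h (0, 0) ⟨by norm_num, le_rfl⟩ (by simp), h0]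
  have : z = z.1 • ((1 : ℝ), (0 : E d)) + ((0 : ℝ), z.2) := by ext <;> simp
  conv_rhs => rw [this, map_add, map_smul]
  simp [add_assoc]

/-- On the unit cylinder, a function with bounded Zygmund seminorm is close to the Taylor
expansion of its mollification. -/
lemma exists_sub_stmollTaylor_le (hηs : ContDiff ℝ (⊤ : ℕ∞) η) (hζs : ContDiff ℝ (⊤ : ℕ∞) ζ)
    (hη : ∀ s : ℝ, s ∉ Ioo (-1 : ℝ) 1 → η s = 0)
    (hζ : ∀ y : E d, y ∉ ball (0 : E d) 1 → ζ y = 0)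
    (hηi : ∫ s, η s = 1) (hζi : ∫ y, ζ y = 1) (hζe : ∀ y, ζ (-y) = ζ y) :
    ∃ C : ℝ, 1 ≤ C ∧ ∀ (u : ℝ × E d → ℝ) (Z : ℝ), ContinuousOn u (lowerHalf d) →
      ZygmundBound u Z → ∀ z ∈ Ioo (-1 : ℝ) 0 ×ˢ ball (0 : E d) 1,
        |u z - stmollTaylor 1 η ζ u z| ≤ C * Z := by
  obtain ⟨K, hKs, hKc, hK⟩ := exists_stmoll_eq_convolution hηs hζs hη hζ
  set I₀ := ∫ w, ‖K w‖ with hI₀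
  set I₁ := ∫ w, ‖fderiv ℝ K w‖ with hI₁
  have hI₀0 : 0 ≤ I₀ := integral_nonneg fun _ => norm_nonneg _
  have hI₁0 : 0 ≤ I₁ := integral_nonneg fun _ => norm_nonneg _
  set C₁ : ℝ := 12 + (2 * d + 2) * d + 2 * d with hC₁
  have hC₁1 : 1 ≤ C₁ := by
    have : (0 : ℝ) ≤ (2 * d + 2) * d + 2 * d := by positivity
    linarith
  refine ⟨C₁ * (1 + I₀ + I₁), by nlinarith, fun u Z hc hu z hz => ?_⟩
  obtain ⟨a, b, L, hℓ⟩ := hu.exists_affine_approx hc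
  set T : Set (ℝ × E d) := Ico (-5 : ℝ) 0 ×ˢ closedBall (0 : E d) 2 with hT
  set v : ℝ × E d → ℝ := T.piecewise (fun z => u z - (a + z.1 * b + L z.2)) 0 with hv
  have hTm : MeasurableSet T := measurableSet_Ico.prod measurableSet_closedBall
  have hTl : T ⊆ lowerHalf d := fun w hw => mem_lowerHalf.2 hw.1.2
  have hvm : Measurable v := by
    refine ContinuousOn.measurable_piecewise ?_ continuousOn_const hTm
    exact (hc.mono hTl).sub (Continuous.continuousOn (by fun_prop))
  have hZ := hu.nonneg
  have hvM : ∀ w, |v w| ≤ C₁ * Z := by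
    intro w
    by_cases hw : w ∈ T
    · rw [hv, piecewise_eq_of_mem _ _ _ hw]
      exact hℓ w hw
    · rw [hv, piecewise_eq_of_notMem _ _ _ hw]
      simp only [Pi.zero_apply, abs_zero]
      positivity
  have huv : ∀ w ∈ T, u w = a + w.1 * b + L w.2 + v w := by
    intro w hw
    rw [hv, piecewise_eq_of_mem _ _ _ hw]
    ring
  obtain ⟨V', hV', hVn, hV'n⟩ :=
    exists_hasFDerivAt_convolution (volume : Measure (ℝ × E d)) hvm hvM hKs hKc 0
  set V := convolution v K (ContinuousLinearMap.mul ℝ ℝ) volume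
  have hW : HasFDerivAt (fun w : ℝ × E d => a + w.1 * b + L w.2 + V w)
      (b • ContinuousLinearMap.fst ℝ ℝ (E d) + L.comp (ContinuousLinearMap.snd ℝ ℝ (E d)) + V')
      0 := by
    refine HasFDerivAt.add (HasFDerivAt.add ?_ ?_) hV'
    · exact (hasFDerivAt_fst.mul_const b).const_add a
    · exact L.hasFDerivAt.comp _ hasFDerivAt_snd
  have hTay := stmollTaylor_eq_of_hasFDerivAt hW (u := u) (η := η) (ζ := ζ) (fun w hw hw' => by
    rw [stmoll_eq_affine_add hηs hζs hη hζ hηi hζi hζe hvm hvM huv hw hw',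
      hK v _ hvm hvM]) z
  obtain ⟨hz1, hz2⟩ := hz
  rw [mem_ball_zero_iff] at hz2
  have hzT : z ∈ T := ⟨⟨by linarith [hz1.1], hz1.2⟩, by simpa using by linarith⟩
  have hzn : ‖z‖ ≤ 1 := by
    rw [Prod.norm_def]
    exact max_le (abs_le.2 ⟨by linarith [hz1.1], by linarith [hz1.2]⟩) hz2.le
  have e : u z - stmollTaylor 1 η ζ u z = v z - V 0 - V' z := by
    rw [hTay, huv z hzT]
    simp
    ring
  have h1 := hvM z
  have h2 : |V' z| ≤ C₁ * Z * I₁ := by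
    refine (V'.le_opNorm z).trans ((mul_le_of_le_one_right (norm_nonneg _) hzn).trans hV'n)
  rw [e]
  calc |v z - V 0 - V' z| ≤ |v z| + |V 0| + |V' z| := by
        refine (abs_sub _ _).trans ?_
        gcongr
        exact abs_sub _ _
    _ ≤ C₁ * Z + C₁ * Z * I₀ + C₁ * Z * I₁ := by gcongr
    _ = _ := by ring

end Nonlocal
namespace Nonlocal

variable {d : ℕ}

namespace ZygmundBound

variable {v : ℝ × E d → ℝ} {Z M : ℝ}

/-- A function with bounded Zygmund seminorm that is bounded on the unit cylinder grows at most
like `r log r`. -/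
lemma abs_le_of_abs_le (hv : ZygmundBound v Z) (hZM : Z ≤ M)
    (h1 : ∀ z ∈ Ioo (-1 : ℝ) 0 ×ˢ ball (0 : E d) 1, |v z| ≤ M) (j : ℕ) :
    ∀ z : ℝ × E d, -2 ^ j < z.1 → z.1 < 0 → ‖z.2‖ < 2 ^ j → |v z| ≤ (j + 1) * 2 ^ j * M := by
  have hM : 0 ≤ M := hv.nonneg.trans hZM
  induction j with
  | zero =>
    intro z hz1 hz2 hz3
    simp only [pow_zero] at hz1 hz3
    simpa using h1 z ⟨⟨hz1, hz2⟩, by simpa using hz3⟩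
  | succ j ih =>
    rintro ⟨t, x⟩ hz1 hz2 hz3
    simp only at hz1 hz2 hz3
    have h2 : (1 : ℝ) ≤ 2 ^ j := one_le_pow₀ one_le_two
    rw [pow_succ] at hz1 hz3
    obtain ⟨s, hs1, hs2, hs3⟩ : ∃ s : ℝ, -1 < s ∧ s < 0 ∧ -(2 ^ j * 2) < s + t := by
      refine ⟨-(min 1 (2 ^ j * 2 + t)) / 2, ?_, ?_, ?_⟩
      · linarith [min_le_left 1 (2 ^ j * 2 + t)]
      · have : 0 < min 1 (2 ^ j * 2 + t) := lt_min one_pos (by linarith)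
        linarith
      · linarith [min_le_right 1 (2 ^ j * 2 + t)]
    have hmid := hv.midpoint (z := (s, 0)) (w := (t, x)) hs2 hz2
    have hn : ‖((s, (0 : E d)) : ℝ × E d) - (t, x)‖ ≤ 2 ^ j * 2 := by
      rw [Prod.norm_def]
      refine max_le (abs_le.2 ⟨?_, ?_⟩) ?_
      · simp only [Prod.fst_sub]; linarith
      · simp only [Prod.fst_sub]; linarith
      · simpa using hz3.le
    have hc := h1 (s, 0) ⟨⟨hs1, hs2⟩, by simp⟩
    have hm := ih ((1 / 2 : ℝ) • ((s, (0 : E d)) + (t, x)))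
      (by simp only [Prod.smul_fst, Prod.fst_add, smul_eq_mul]; linarith)
      (by simp only [Prod.smul_fst, Prod.fst_add, smul_eq_mul]; linarith)
      (by
        simp only [Prod.smul_snd, Prod.snd_add, zero_add, norm_smul]
        norm_num
        linarith)
    have he : Z / 2 * ‖((s, (0 : E d)) : ℝ × E d) - (t, x)‖ ≤ 2 ^ j * M := by
      calc Z / 2 * ‖((s, (0 : E d)) : ℝ × E d) - (t, x)‖ ≤ M / 2 * (2 ^ j * 2) := by gcongr
        _ = _ := by ring
    have hM2 : M ≤ 2 ^ j * M := le_mul_of_one_le_left hM h2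
    have e : ((j + 1 : ℕ) + 1 : ℝ) * 2 ^ (j + 1) * M =
        2 * ((j + 1) * 2 ^ j * M) + 2 * (2 ^ j * M) := by
      push_cast
      ring
    rw [e]
    rw [abs_le] at *
    constructor <;> linarith

/-- Increments of a function with bounded Zygmund seminorm, compared with those at a dyadically
larger scale. -/
lemma abs_add_sub_le (hv : ZygmundBound v Z) {z h : ℝ × E d} (hz : z.1 < 0) (hh : h.1 ≤ 0)
    (k : ℕ) :
    |v (z + h) - v z| ≤ |v (z + (2 : ℝ) ^ k • h) - v z| / 2 ^ k + k * (Z * ‖h‖ / 2) := by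
  induction k with
  | zero => simp
  | succ k ih =>
    have hmid := hv.midpoint (z := z) (w := z + (2 : ℝ) ^ (k + 1) • h) hz (by
      have : (2 : ℝ) ^ (k + 1) * h.1 ≤ 0 := mul_nonpos_of_nonneg_of_nonpos (by positivity) hh
      simp only [Prod.fst_add, Prod.smul_fst, smul_eq_mul]
      linarith)
    have e1 : (1 / 2 : ℝ) • (z + (z + (2 : ℝ) ^ (k + 1) • h)) = z + (2 : ℝ) ^ k • h := by
      rw [pow_succ]
      module
    have e2 : ‖z - (z + (2 : ℝ) ^ (k + 1) • h)‖ = 2 ^ (k + 1) * ‖h‖ := by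
      rw [sub_add_cancel_left, norm_neg, norm_smul, Real.norm_of_nonneg (by positivity)]
    rw [e1, e2] at hmid
    have hk : (0 : ℝ) < 2 ^ k := by positivity
    have h3 : |v (z + (2 : ℝ) ^ k • h) - v z| ≤
        |v (z + (2 : ℝ) ^ (k + 1) • h) - v z| / 2 + 2 ^ k * (Z * ‖h‖ / 2) := by
      rw [pow_succ] at *
      have h4 := abs_le.1 hmid
      have h5 := le_abs_self (v (z + ((2 : ℝ) ^ k * 2) • h) - v z)
      have h6 := neg_abs_le (v (z + ((2 : ℝ) ^ k * 2) • h) - v z)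
      rw [abs_le]
      constructor <;> linarith
    have h4 : |v (z + (2 : ℝ) ^ k • h) - v z| / 2 ^ k ≤
        |v (z + (2 : ℝ) ^ (k + 1) • h) - v z| / 2 ^ (k + 1) + Z * ‖h‖ / 2 := by
      rw [div_le_iff₀ hk]
      refine h3.trans_eq ?_
      rw [pow_succ]
      field_simp
    push_cast
    linarith

/-- The logarithmic Lipschitz estimate on a large cylinder. -/
lemma exists_abs_sub_le (hv : ZygmundBound v Z) (hZM : Z ≤ M)
    (h1 : ∀ z ∈ Ioo (-1 : ℝ) 0 ×ˢ ball (0 : E d) 1, |v z| ≤ M) (j : ℕ) {z w : ℝ × E d}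
    (hz : z ∈ Ioo (-1 : ℝ) 0 ×ˢ ball (0 : E d) (2 ^ j))
    (hw : w ∈ Ioo (-1 : ℝ) 0 ×ˢ ball (0 : E d) (2 ^ j)) (hzw : z ≠ w) :
    ‖z - w‖ ≤ 2 ^ (j + 1) ∧ ∃ k : ℕ, (2 : ℝ) ^ k ≤ 2 ^ (j + 1) / ‖z - w‖ ∧
      |v z - v w| ≤ (8 * (j + 3) + k / 2) * ‖z - w‖ * M := by
  wlog hle : w.1 ≤ z.1 generalizing z w
  · have := this hw hz hzw.symm (le_of_not_ge hle)
    rwa [norm_sub_rev w z, abs_sub_comm (v w)] at this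
  have hM : 0 ≤ M := hv.nonneg.trans hZM
  have h2 : (1 : ℝ) ≤ 2 ^ j := one_le_pow₀ one_le_two
  obtain ⟨⟨hz1, hz2⟩, hz3⟩ := hz
  obtain ⟨⟨hw1, hw2⟩, hw3⟩ := hw
  rw [mem_ball_zero_iff] at hz3 hw3
  set ρ := ‖z - w‖ with hρ
  have hρ0 : 0 < ρ := norm_pos_iff.2 (sub_ne_zero.2 hzw)
  have hρj : ρ ≤ 2 ^ (j + 1) := by
    rw [pow_succ, hρ, Prod.norm_def]
    refine max_le (abs_le.2 ⟨?_, ?_⟩) ?_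
    · simp only [Prod.fst_sub]; linarith
    · simp only [Prod.fst_sub]; linarith
    · exact (norm_sub_le _ _).trans (by linarith)
  obtain ⟨k, hk1, hk2⟩ := exists_nat_pow_near ((one_le_div hρ0).2 hρj) one_lt_two
  refine ⟨hρj, k, hk1, ?_⟩
  have hk0 : (0 : ℝ) < 2 ^ k := by positivity
  rw [le_div_iff₀ hρ0] at hk1
  rw [div_lt_iff₀ hρ0] at hk2
  have hd := hv.abs_add_sub_le (z := z) (h := w - z) hz2 (by simpa using hle) k
  rw [add_sub_cancel, norm_sub_rev, ← hρ] at hd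
  have hs1 : 2 ^ k * |z.1 - w.1| ≤ 2 ^ (j + 1) :=
    (mul_le_mul_of_nonneg_left (norm_fst_le (z - w)) hk0.le).trans hk1
  have hs2 : 2 ^ k * ‖w.2 - z.2‖ ≤ 2 ^ (j + 1) := by
    rw [norm_sub_rev]
    exact (mul_le_mul_of_nonneg_left (norm_snd_le (z - w)) hk0.le).trans hk1
  rw [abs_of_nonneg (by linarith)] at hs1
  have e4 : (2 : ℝ) ^ (j + 2) = 4 * 2 ^ j := by ring
  have e2 : (2 : ℝ) ^ (j + 1) = 2 * 2 ^ j := by ring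
  have hg1 := hv.abs_le_of_abs_le hZM h1 (j + 2) z (by linarith) hz2 (by linarith)
  have hg2 := hv.abs_le_of_abs_le hZM h1 (j + 2) (z + (2 : ℝ) ^ k • (w - z))
    (by
      simp only [Prod.fst_add, Prod.smul_fst, Prod.fst_sub, smul_eq_mul]
      linarith)
    (by
      have : (2 : ℝ) ^ k * (w.1 - z.1) ≤ 0 :=
        mul_nonpos_of_nonneg_of_nonpos hk0.le (by linarith)
      simp only [Prod.fst_add, Prod.smul_fst, Prod.fst_sub, smul_eq_mul]
      linarith)
    (by
      simp only [Prod.snd_add, Prod.smul_snd, Prod.snd_sub]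
      refine (norm_add_le _ _).trans_lt ?_
      rw [norm_smul, Real.norm_of_nonneg hk0.le]
      linarith)
  push_cast at hg1 hg2
  rw [abs_sub_comm]
  have h5 : |v (z + (2 : ℝ) ^ k • (w - z)) - v z| / 2 ^ k ≤ 8 * (j + 3) * ρ * M := by
    rw [div_le_iff₀ hk0]
    have hk3 : 2 ^ j ≤ 2 ^ k * ρ := by
      rw [pow_succ, pow_succ] at hk2
      linarith
    calc |v (z + (2 : ℝ) ^ k • (w - z)) - v z|
        ≤ |v (z + (2 : ℝ) ^ k • (w - z))| + |v z| := abs_sub _ _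
      _ ≤ 8 * (j + 3) * M * 2 ^ j := by rw [e4] at hg1 hg2; linarith
      _ ≤ 8 * (j + 3) * M * (2 ^ k * ρ) := by gcongr
      _ = _ := by ring
  have h6 : (k : ℝ) * (Z * ρ / 2) ≤ k / 2 * ρ * M := by
    calc (k : ℝ) * (Z * ρ / 2) ≤ k * (M * ρ / 2) := by gcongr
      _ = _ := by ring
  linarith

end ZygmundBound

lemma exists_nat_add_three_le_rpow {ε : ℝ} (hε : 0 < ε) :
    ∃ C : ℝ, 0 < C ∧ ∀ n : ℕ, (n : ℝ) + 3 ≤ C * 2 ^ (n * ε) := by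
  have hl : 0 < Real.log 2 := Real.log_pos one_lt_two
  have hc : 0 < ε * Real.log 2 := mul_pos hε hl
  refine ⟨3 + 1 / (ε * Real.log 2), by positivity, fun n => ?_⟩
  have h1 := Real.add_one_le_exp (Real.log 2 * (n * ε))
  rw [← Real.rpow_def_of_pos two_pos] at h1
  have h2 : (1 : ℝ) ≤ 2 ^ ((n : ℝ) * ε) := Real.one_le_rpow one_le_two (by positivity)
  have h3 : (n : ℝ) ≤ 1 / (ε * Real.log 2) * 2 ^ ((n : ℝ) * ε) := by
    rw [div_mul_eq_mul_div, one_mul, le_div_iff₀ hc]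
    linarith
  linarith

/-- A function with bounded Zygmund seminorm that is bounded on the unit cylinder satisfies
a Hölder estimate on larger cylinders. -/
lemma exists_holder_of_zygmundBound {α : ℝ} (hα : α ∈ Ioo (0 : ℝ) 1) :
    ∃ C : ℝ, 0 < C ∧ ∀ (d : ℕ) (v : ℝ × E d → ℝ) (Z M : ℝ), ZygmundBound v Z → Z ≤ M →
      (∀ z ∈ Ioo (-1 : ℝ) 0 ×ˢ ball (0 : E d) 1, |v z| ≤ M) → ∀ j : ℕ,
      ∀ z ∈ Ioo (-1 : ℝ) 0 ×ˢ ball (0 : E d) (2 ^ j),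
      ∀ w ∈ Ioo (-1 : ℝ) 0 ×ˢ ball (0 : E d) (2 ^ j),
        |v z - v w| ≤ C * 2 ^ ((j : ℝ) * (1 - α / 2)) * M * ‖z - w‖ ^ α := by
  obtain ⟨hα0, hα1⟩ := hα
  obtain ⟨C₁, hC₁, h₁⟩ := exists_nat_add_three_le_rpow (half_pos hα0)
  obtain ⟨C₂, hC₂, h₂⟩ := exists_nat_add_three_le_rpow (sub_pos.2 hα1)
  refine ⟨16 * C₁ + C₂, by positivity, fun d v Z M hv hZM hM j z hz w hw => ?_⟩
  have hM0 : 0 ≤ M := hv.nonneg.trans hZM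
  by_cases hzw : z = w
  · subst hzw
    rw [sub_self, abs_zero]
    positivity
  obtain ⟨hρj, k, hk, h⟩ := hv.exists_abs_sub_le hZM hM j hz hw hzw
  have hρ : 0 < ‖z - w‖ := norm_pos_iff.2 (sub_ne_zero.2 hzw)
  set ρ := ‖z - w‖
  refine h.trans ?_
  have hρα : ρ = ρ ^ α * ρ ^ (1 - α) := by
    rw [← Real.rpow_add hρ, add_sub_cancel, Real.rpow_one]
  have h2j : ((2 : ℝ) ^ (j + 1)) ^ (1 - α) ≤ 2 * 2 ^ ((j : ℝ) * (1 - α)) := by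
    rw [← Real.rpow_natCast, ← Real.rpow_mul zero_le_two, Nat.cast_add, Nat.cast_one, add_mul,
      one_mul, Real.rpow_add two_pos, mul_comm]
    gcongr
    exact (Real.rpow_le_rpow_of_exponent_le one_le_two (by linarith)).trans_eq (Real.rpow_one 2)
  have hρ1 : ρ ^ (1 - α) ≤ 2 * 2 ^ ((j : ℝ) * (1 - α)) :=
    (Real.rpow_le_rpow hρ.le hρj (by linarith)).trans h2j
  have hj : ((j : ℝ) + 3) * ρ ≤ 2 * C₁ * 2 ^ ((j : ℝ) * (1 - α / 2)) * ρ ^ α := by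
    calc ((j : ℝ) + 3) * ρ = (j + 3) * ρ ^ (1 - α) * ρ ^ α := by
          conv_lhs => rw [hρα]
          ring
      _ ≤ (C₁ * 2 ^ ((j : ℝ) * (α / 2))) * (2 * 2 ^ ((j : ℝ) * (1 - α))) * ρ ^ α := by
          gcongr
          exact h₁ j
      _ = 2 * C₁ * (2 ^ ((j : ℝ) * (α / 2)) * 2 ^ ((j : ℝ) * (1 - α))) * ρ ^ α := by ring
      _ = _ := by
          rw [← Real.rpow_add two_pos]
          ring_nf
  have hk' : (k : ℝ) * ρ ≤ 2 * C₂ * 2 ^ ((j : ℝ) * (1 - α / 2)) * ρ ^ α := by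
    have h3 : (2 : ℝ) ^ ((k : ℝ) * (1 - α)) * ρ ^ (1 - α) ≤ 2 * 2 ^ ((j : ℝ) * (1 - α)) := by
      refine le_trans ?_ h2j
      rw [Real.rpow_mul zero_le_two, Real.rpow_natCast, ← Real.mul_rpow (by positivity) hρ.le]
      exact Real.rpow_le_rpow (by positivity) ((le_div_iff₀ hρ).1 hk) (by linarith)
    calc (k : ℝ) * ρ = k * ρ ^ (1 - α) * ρ ^ α := by
          conv_lhs => rw [hρα]
          ring
      _ ≤ (C₂ * 2 ^ ((k : ℝ) * (1 - α))) * ρ ^ (1 - α) * ρ ^ α := by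
          gcongr
          linarith [h₂ k]
      _ = C₂ * (2 ^ ((k : ℝ) * (1 - α)) * ρ ^ (1 - α)) * ρ ^ α := by ring
      _ ≤ C₂ * (2 * 2 ^ ((j : ℝ) * (1 - α / 2))) * ρ ^ α := by
          refine mul_le_mul_of_nonneg_right (mul_le_mul_of_nonneg_left (h3.trans ?_) hC₂.le)
            (by positivity)
          gcongr
          · exact one_le_two
          · linarith
      _ = _ := by ring
  calc (8 * ((j : ℝ) + 3) + k / 2) * ρ * M = (8 * ((j + 3) * ρ) + (k * ρ) / 2) * M := by ring
    _ ≤ (8 * (2 * C₁ * 2 ^ ((j : ℝ) * (1 - α / 2)) * ρ ^ α) +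
          (2 * C₂ * 2 ^ ((j : ℝ) * (1 - α / 2)) * ρ ^ α) / 2) * M := by gcongr
    _ = _ := by ring

section Scaling

variable {u : ℝ × E d → ℝ} {Z R : ℝ} {η : ℝ → ℝ} {ζ : E d → ℝ}

lemma ZygmundBound.comp_smul (hu : ZygmundBound u Z) (hR : 0 < R) :
    ZygmundBound (fun z => u (R • z)) (R * Z) := by
  intro z h hh h1 h2 h3
  have hl : ∀ z : ℝ × E d, z ∈ lowerHalf d → R • z ∈ lowerHalf d := fun z hz =>
    mem_lowerHalf.2 (mul_neg_of_pos_of_neg hR (mem_lowerHalf.1 hz))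
  have := hu (R • z) (R • h) (smul_ne_zero hR.ne' hh) (hl _ h1)
    (by rw [← smul_add]; exact hl _ h2) (by rw [← smul_sub]; exact hl _ h3)
  rw [← smul_add, ← smul_sub, norm_smul, Real.norm_of_nonneg hR.le] at this
  exact this.trans_eq (by ring)

lemma stmoll_smul (z : ℝ × E d) :
    stmoll R η ζ u (R • z) = stmoll 1 η ζ (fun z => u (R • z)) z := by
  refine integral_congr_ae (Filter.Eventually.of_forall fun w => ?_)
  simp only [Prod.smul_fst, Prod.smul_snd, Prod.smul_mk, smul_eq_mul, one_mul, mul_one, one_smul,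
    mul_sub, smul_sub]
  ring_nf

lemma stmollTaylor_smul (hR : 0 < R) (z : ℝ × E d) :
    stmollTaylor R η ζ u (R • z) = stmollTaylor 1 η ζ (fun z => u (R • z)) z := by
  have h0 : stmoll 1 η ζ (fun z => u (R • z)) (0, 0) = stmoll R η ζ u (0, 0) := by
    rw [← stmoll_smul]
    simp
  have ht : derivWithin (fun s => stmoll 1 η ζ (fun z => u (R • z)) (s, (0 : E d)))
      (Iio (0 : ℝ)) 0 =
      R * derivWithin (fun s => stmoll R η ζ u (s, (0 : E d))) (Iio (0 : ℝ)) 0 := by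
    have e : (fun s => stmoll 1 η ζ (fun z => u (R • z)) (s, (0 : E d))) =
        fun s => (fun s => stmoll R η ζ u (s, (0 : E d))) (R * s) := by
      funext s
      rw [← stmoll_smul]
      simp
    open scoped Pointwise in
    have hs : R • Iio (0 : ℝ) = Iio 0 := by
      rw [LinearOrderedField.smul_Iio hR, mul_zero]
    rw [e, derivWithin_comp_mul_left (f := fun s => stmoll R η ζ u (s, (0 : E d))), hs, mul_zero, smul_eq_mul]
  have hx : fderiv ℝ (fun x => stmoll 1 η ζ (fun z => u (R • z)) ((0 : ℝ), x)) 0 =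
      R • fderiv ℝ (fun x => stmoll R η ζ u ((0 : ℝ), x)) 0 := by
    have e : (fun x => stmoll 1 η ζ (fun z => u (R • z)) ((0 : ℝ), x)) =
        fun x => (fun x => stmoll R η ζ u ((0 : ℝ), x)) (R • x) := by
      funext x
      rw [← stmoll_smul]
      simp
    rw [e, fderiv_comp_smul (f := fun x => stmoll R η ζ u ((0 : ℝ), x)), smul_zero]
  rw [stmollTaylor, stmollTaylor, h0, ht, hx]
  simp only [Prod.smul_fst, Prod.smul_snd, smul_eq_mul, map_smul, smul_apply]
  ring

end Scaling

end Nonlocal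


/-- Lemma 5.4 (case σ = 1): the Hölder estimate for `u - p`, where `p` is
the first-order Taylor expansion at the origin of the space-time mollification `u^{(R)}`. -/
theorem statement18 (d : ℕ) (hd : 1 ≤ d) (α : ℝ) (hα : α ∈ Ioo (0 : ℝ) 1)
    -- the mollifier η: smooth, even, nonnegative, unit integral, supported in (-1,1)
    (η : ℝ → ℝ) (hηs : ContDiff ℝ (⊤ : ℕ∞) η) (hηe : ∀ s : ℝ, η (-s) = η s)
    (hηnn : ∀ s : ℝ, 0 ≤ η s) (hηi : (∫ s : ℝ, η s) = 1)
    (hηsupp : ∀ s : ℝ, s ∉ Ioo (-1 : ℝ) 1 → η s = 0)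
    -- the spatial mollifier ζ: smooth, radial, nonnegative, unit integral, supported in B₁
    (ζ : E d → ℝ) (hζs : ContDiff ℝ (⊤ : ℕ∞) ζ) (hζnn : ∀ y : E d, 0 ≤ ζ y)
    (hζrad : ∀ y y' : E d, ‖y‖ = ‖y'‖ → ζ y = ζ y')
    (hζi : (∫ y : E d, ζ y) = 1)
    (hζsupp : ∀ y : E d, y ∉ ball (0 : E d) 1 → ζ y = 0) :
    ∃ C : ℝ, 0 < C ∧
      ∀ R : ℝ, 0 < R →
      ∀ (u : ℝ × E d → ℝ) (Z : ℝ),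
        -- u is continuous on ℝ₀^{d+1}
        ContinuousOn u (lowerHalf d) →
        -- [u]_{Λ¹(ℝ₀^{d+1})} ≤ Z
        (∀ z h : ℝ × E d, h ≠ 0 → z ∈ lowerHalf d → z + h ∈ lowerHalf d →
          z - h ∈ lowerHalf d → |u (z + h) + u (z - h) - 2 * u z| ≤ Z * ‖h‖) →
        -- conclusion (5.6)
        ∀ j : ℕ, ∀ z ∈ (Ioo (-R) (0 : ℝ) ×ˢ ball (0 : E d) ((2 : ℝ) ^ j * R)),
          ∀ w ∈ (Ioo (-R) (0 : ℝ) ×ˢ ball (0 : E d) ((2 : ℝ) ^ j * R)),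
          |(u z - stmollTaylor R η ζ u z) - (u w - stmollTaylor R η ζ u w)| ≤
            C * (2 : ℝ) ^ ((j : ℝ) * (1 - α / 2)) * R ^ (1 - α) * Z *
              max (‖z.2 - w.2‖ ^ α) (|z.1 - w.1| ^ α) := by
  have hζe : ∀ y, ζ (-y) = ζ y := fun y => hζrad _ _ (norm_neg y)
  obtain ⟨C₁, hC₁, h₁⟩ := exists_sub_stmollTaylor_le hηs hζs hηsupp hζsupp hηi hζi hζe
  obtain ⟨C₂, hC₂, h₂⟩ := exists_holder_of_zygmundBound hα
  refine ⟨C₂ * C₁, by positivity, fun R hR u Z hc hu j z hz w hw => ?_⟩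
  have hu' : ZygmundBound u Z := hu
  have huR := hu'.comp_smul hR
  have hcR : ContinuousOn (fun z : ℝ × E d => u (R • z)) (lowerHalf d) :=
    hc.comp (continuous_const_smul R).continuousOn fun z hz =>
      mem_lowerHalf.2 (mul_neg_of_pos_of_neg hR (mem_lowerHalf.1 hz))
  have hscale : ∀ z ∈ Ioo (-R) (0 : ℝ) ×ˢ ball (0 : E d) (2 ^ j * R),
      R⁻¹ • z ∈ Ioo (-1 : ℝ) 0 ×ˢ ball (0 : E d) (2 ^ j) := by
    rintro z ⟨⟨hz1, hz2⟩, hz3⟩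
    rw [mem_ball_zero_iff] at hz3
    refine ⟨⟨?_, ?_⟩, ?_⟩
    · rw [Prod.smul_fst, smul_eq_mul, inv_mul_eq_div, lt_div_iff₀ hR]
      linarith
    · exact mul_neg_of_pos_of_neg (inv_pos.2 hR) hz2
    · rw [mem_ball_zero_iff, Prod.smul_snd, norm_smul, norm_inv, Real.norm_of_nonneg hR.le,
        inv_mul_eq_div, div_lt_iff₀ hR]
      exact hz3
  have key := h₂ d (fun z => u (R • z) - stmollTaylor 1 η ζ (fun z => u (R • z)) z) (R * Z)
    (C₁ * (R * Z)) (huR.sub_affine _ _ _) (le_mul_of_one_le_left huR.nonneg hC₁)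
    (h₁ _ _ hcR huR) j (R⁻¹ • z) (hscale z hz) (R⁻¹ • w) (hscale w hw)
  simp only [← stmollTaylor_smul hR, smul_inv_smul₀ hR.ne', ← smul_sub] at key
  have hn : ‖R⁻¹ • (z - w)‖ ^ α = R ^ (-α) * ‖z - w‖ ^ α := by
    rw [norm_smul, norm_inv, Real.norm_of_nonneg hR.le,
      Real.mul_rpow (inv_nonneg.2 hR.le) (norm_nonneg _), Real.inv_rpow hR.le, Real.rpow_neg hR.le]
  have hmax : ‖z - w‖ ^ α ≤ max (‖z.2 - w.2‖ ^ α) (|z.1 - w.1| ^ α) := by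
    rw [Prod.norm_def]
    rcases max_choice ‖(z - w).1‖ ‖(z - w).2‖ with h | h <;> rw [h]
    · exact le_max_right _ _
    · exact le_max_left _ _
  have hZ : 0 ≤ Z := hu'.nonneg
  have hRα : R ^ (1 - α) = R * R ^ (-α) := by
    rw [sub_eq_add_neg, Real.rpow_add hR, Real.rpow_one]
  refine key.trans ?_
  rw [hn]
  calc C₂ * 2 ^ ((j : ℝ) * (1 - α / 2)) * (C₁ * (R * Z)) * (R ^ (-α) * ‖z - w‖ ^ α)
      = C₂ * C₁ * 2 ^ ((j : ℝ) * (1 - α / 2)) * R ^ (1 - α) * Z * ‖z - w‖ ^ α := by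
        rw [hRα]
        ring
    _ ≤ _ := by gcongr
end
end
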